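/- arXiv:1202.4654 — 2 statements merged into one kernel-verified Lean document; each statement's English description precedes it below -/
import Mathlib

section
/- Assume hypotheses (H), let λ_0 be a principal eigenvalue for the weight f_0, and let λ_∞ be a principal eigenvalue for the weight f_∞ if f_∞>0 on [0,1], while λ_∞:=+∞ if f_∞≡0 (and N=1). Then: (a) every nontrivial solution (λ,u) of (P) with λ>0 satisfies λ_0≤λ≤λ_∞; (b) if (λ_n,u_n) is a sequence of nontrivial solutions of (P) with λ_n>0 and |u_n|_0→0, then λ_n→λ_0; (c) if instead |u_n|_0→∞, then λ_n→λ_∞ when f_∞>0 on [0,1], and λ_n→∞ when f_∞≡0 and N=1. -/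
open Set MeasureTheory Filter Topology intervalIntegral

noncomputable section

/-- `phi p ξ = |ξ|^(p-2) ξ`, the function `φ_p`. -/
def phi (p ξ : ℝ) : ℝ := |ξ| ^ (p - 2) * ξ

/-- The (one-sided at endpoints) derivative of a function on `[0,1]`. -/
def deriv01 (u : ℝ → ℝ) (r : ℝ) : ℝ := derivWithin u (Set.Icc 0 1) r

/-- `u ∈ C^1([0,1],ℝ)`. -/
def C1on01 (u : ℝ → ℝ) : Prop :=
  (∀ r ∈ Set.Icc (0:ℝ) 1, DifferentiableWithinAt ℝ u (Set.Icc 0 1) r) ∧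
  ContinuousOn (deriv01 u) (Set.Icc 0 1)

/-- `J(h)(s) = ∫_0^s (t/s)^(N-1) h(t) dt`, with `J(h)(0) = 0`. -/
def Jmap (N : ℕ) (h : ℝ → ℝ) (s : ℝ) : ℝ :=
  if s = 0 then 0 else ∫ t in (0:ℝ)..s, (t / s) ^ (N - 1) * h t

/-- `S_p(h)(r) = ∫_r^1 φ_{p'}(J(h)(s)) ds` where `p' = p/(p-1)`. -/
def Sp (p : ℝ) (N : ℕ) (h : ℝ → ℝ) (r : ℝ) : ℝ :=
  ∫ s in r..(1:ℝ), phi (p / (p - 1)) (Jmap N h s)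

/-- The sup norm over `[0,1]`. -/
def norm0 (h : ℝ → ℝ) : ℝ := sSup ((fun t => |h t|) '' Set.Icc 0 1)

/-- `u` is not identically zero on `[0,1]`. -/
def Nontriv01 (u : ℝ → ℝ) : Prop := ∃ r ∈ Set.Icc (0:ℝ) 1, u r ≠ 0

/-- `(lam, u)` is a solution of problem (P):
`-(r^(N-1) φ_p(u'))' = lam r^(N-1) f(r, u(r))` on `(0,1)`, `u'(0) = u(1) = 0`. -/
def IsSolutionP (p : ℝ) (N : ℕ) (f : ℝ → ℝ → ℝ) (lam : ℝ) (u : ℝ → ℝ) : Prop :=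
  C1on01 u ∧ C1on01 (fun r => phi p (deriv01 u r)) ∧
  (∀ r ∈ Set.Ioo (0:ℝ) 1,
      HasDerivAt (fun s => s ^ (N - 1) * phi p (deriv01 u s))
        (-(lam * r ^ (N - 1) * f r (u r))) r) ∧
  deriv01 u 0 = 0 ∧ u 1 = 0

/-- `(lam, v)` is a principal eigenpair for the weight `w`. -/
def IsPrincipalEigenpair (p : ℝ) (N : ℕ) (w : ℝ → ℝ) (lam : ℝ) (v : ℝ → ℝ) : Prop :=
  0 < lam ∧ C1on01 v ∧ C1on01 (fun r => phi p (deriv01 v r)) ∧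
  (∀ r ∈ Set.Ico (0:ℝ) 1, 0 < v r) ∧
  (∀ r ∈ Set.Ioo (0:ℝ) 1,
      HasDerivAt (fun s => s ^ (N - 1) * phi p (deriv01 v s))
        (-(lam * r ^ (N - 1) * w r * phi p (v r))) r) ∧
  deriv01 v 0 = 0 ∧ v 1 = 0

/-- Hypotheses (H) of the paper: (H1)–(H6), with `f₂ = ∂₂f` and asymptotes `f0`, `finf`. -/
structure HypH (p : ℝ) (N : ℕ) (f f₂ : ℝ → ℝ → ℝ) (f0 finf : ℝ → ℝ) : Prop where
  hp : 2 < p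
  hN : 1 ≤ N
  hf_cont : ContinuousOn (fun q : ℝ × ℝ => f q.1 q.2) (Set.Icc 0 1 ×ˢ Set.univ)
  hf_deriv : ∀ r ∈ Set.Icc (0:ℝ) 1, ∀ ξ : ℝ, HasDerivAt (fun t => f r t) (f₂ r ξ) ξ
  hf₂_cont : ContinuousOn (fun q : ℝ × ℝ => f₂ q.1 q.2) (Set.Icc 0 1 ×ˢ Set.univ)
  hH2 : ∀ r ∈ Set.Icc (0:ℝ) 1, ∀ ξ : ℝ, ξ ≠ 0 → 0 < f r ξ
  hf_zero : ∀ r ∈ Set.Icc (0:ℝ) 1, f r 0 = 0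
  hH3 : ∀ r ∈ Set.Icc (0:ℝ) 1, ∀ ξ : ℝ, 0 ≤ ξ → f₂ r ξ * ξ ≤ (p - 1) * f r ξ
  hH3s : ∃ δ > 0, ∃ ε > 0, ∀ r ∈ Set.Ioc (1 - δ) 1, ∀ ξ ∈ Set.Ioo (0:ℝ) ε,
      f₂ r ξ * ξ < (p - 1) * f r ξ
  hf0_cont : ContinuousOn f0 (Set.Icc 0 1)
  hfinf_cont : ContinuousOn finf (Set.Icc 0 1)
  hH4a : ∀ e > 0, ∃ d > 0, ∀ ξ ∈ Set.Ioo (0:ℝ) d, ∀ r ∈ Set.Icc (0:ℝ) 1,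
      |f r ξ / phi p ξ - f0 r| < e
  hH4b : ∀ e > 0, ∃ d > 0, ∀ ξ ∈ Set.Ioo (0:ℝ) d, ∀ r ∈ Set.Icc (0:ℝ) 1,
      |f₂ r ξ / ξ ^ (p - 2) - (p - 1) * f0 r| < e
  hH5 : ∀ e > 0, ∃ M : ℝ, ∀ ξ : ℝ, M ≤ ξ → ∀ r ∈ Set.Icc (0:ℝ) 1,
      |f r ξ / phi p ξ - finf r| < e
  hH6 : (∀ r ∈ Set.Icc (0:ℝ) 1, 0 < finf r) ∨ (N = 1 ∧ ∀ r ∈ Set.Icc (0:ℝ) 1, finf r = 0)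

lemma phi_of_nonneg {p x : ℝ} (hp : 2 < p) (hx : 0 ≤ x) : phi p x = x ^ (p - 1) := by
  rcases hx.eq_or_lt with rfl | hx
  · rw [Real.zero_rpow (by linarith)]; simp [phi]
  · rw [phi, abs_of_pos hx, show p - 1 = (p - 2) + 1 by ring, Real.rpow_add_one hx.ne']

lemma phi_neg (p x : ℝ) : phi p (-x) = -phi p x := by
  simp [phi]

lemma phi_neg_iff {p x : ℝ} : phi p x < 0 ↔ x < 0 := by
  unfold phi
  constructor
  · intro h
    by_contra! hx
    exact absurd h (not_lt.2 (mul_nonneg (Real.rpow_nonneg (abs_nonneg x) _) hx))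
  · intro h
    exact mul_neg_of_pos_of_neg (Real.rpow_pos_of_pos (abs_pos.2 h.ne) _) h

lemma continuous_phi {p : ℝ} (hp : 2 < p) : Continuous (phi p) :=
  (continuous_abs.rpow_const fun _ => Or.inr (by linarith)).mul continuous_id

/-- The convexity inequality behind Picone's identity. -/
lemma picone_young {p x z : ℝ} (hp : 2 < p) (hx : 0 ≤ x) (hz : 0 ≤ z) :
    0 ≤ x ^ p - p * z ^ (p - 1) * x + (p - 1) * z ^ p := by
  have h := Real.young_inequality_of_nonneg hx (Real.rpow_nonneg hz (p - 1))
    (Real.HolderConjugate.conjExponent (by linarith : 1 < p))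
  have h2 : (z ^ (p - 1)) ^ (p.conjExponent) = z ^ p := by
    rw [← Real.rpow_mul hz, Real.conjExponent]
    congr 1
    field_simp [show p - 1 ≠ 0 by linarith]
  rw [h2, Real.conjExponent] at h
  have hp0 : p ≠ 0 := by linarith
  have hp1 : p - 1 ≠ 0 := by linarith
  have h3 := mul_le_mul_of_nonneg_left h (by linarith : 0 ≤ p)
  have h4 : p * (x ^ p / p + z ^ p / (p / (p - 1))) = x ^ p + (p - 1) * z ^ p := by
    field_simp
  rw [h4] at h3
  linarith

lemma C1on01.hasDerivWithinAt {u : ℝ → ℝ} (hu : C1on01 u) {r : ℝ} (hr : r ∈ Icc (0:ℝ) 1) :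
    HasDerivWithinAt u (deriv01 u r) (Icc 0 1) r :=
  (hu.1 r hr).hasDerivWithinAt

lemma C1on01.hasDerivAt {u : ℝ → ℝ} (hu : C1on01 u) {r : ℝ} (hr : r ∈ Ioo (0:ℝ) 1) :
    HasDerivAt u (deriv01 u r) r :=
  (hu.hasDerivWithinAt (Ioo_subset_Icc_self hr)).hasDerivAt (Icc_mem_nhds hr.1 hr.2)

lemma C1on01.continuousOn {u : ℝ → ℝ} (hu : C1on01 u) : ContinuousOn u (Icc 0 1) :=
  fun r hr => (hu.1 r hr).continuousWithinAt

/-- The flux `r^(N-1) φ_p(u'(r))`. -/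
def flux (p : ℝ) (N : ℕ) (u : ℝ → ℝ) (r : ℝ) : ℝ := r ^ (N - 1) * phi p (deriv01 u r)

lemma continuousOn_flux {p : ℝ} (hp : 2 < p) (N : ℕ) {u : ℝ → ℝ} (hu : C1on01 u) :
    ContinuousOn (flux p N u) (Icc 0 1) :=
  (continuousOn_id.pow _).mul ((continuous_phi hp).comp_continuousOn hu.2)

lemma flux_zero {p : ℝ} {N : ℕ} {u : ℝ → ℝ} (h : deriv01 u 0 = 0) : flux p N u 0 = 0 := by
  simp [flux, h, phi]

lemma deriv01_neg_of_flux_neg {p : ℝ} {N : ℕ} {u : ℝ → ℝ} {r : ℝ} (hr : 0 ≤ r)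
    (h : flux p N u r < 0) : deriv01 u r < 0 := by
  by_contra! hx
  exact absurd h (not_lt.2 (mul_nonneg (pow_nonneg hr _)
    (not_lt.1 fun hneg => absurd (phi_neg_iff.1 hneg) (not_lt.2 hx))))

lemma strictAntiOn_of_deriv01_neg {u : ℝ → ℝ} (hu : C1on01 u)
    (h : ∀ r ∈ Ioc (0:ℝ) 1, deriv01 u r < 0) : StrictAntiOn u (Icc 0 1) := by
  refine strictAntiOn_of_deriv_neg (convex_Icc 0 1) hu.continuousOn fun r hr => ?_
  rw [interior_Icc] at hr
  rw [(hu.hasDerivAt hr).deriv]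
  exact h r (Ioo_subset_Ioc_self hr)

/-- `u` is a positive solution of `-(r^(N-1) φ_p(u'))' = r^(N-1) g(r)`, `u'(0) = u(1) = 0`,
with positive right-hand side `g`. -/
structure IsPosSol (p : ℝ) (N : ℕ) (g u : ℝ → ℝ) : Prop where
  c1 : C1on01 u
  pos : ∀ r ∈ Ico (0:ℝ) 1, 0 < u r
  g_pos : ∀ r ∈ Ioo (0:ℝ) 1, 0 < g r
  eqn : ∀ r ∈ Ioo (0:ℝ) 1, HasDerivAt (flux p N u) (-(r ^ (N - 1) * g r)) r
  deriv_zero : deriv01 u 0 = 0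
  map_one : u 1 = 0

namespace IsPosSol

variable {p : ℝ} {N : ℕ} {g gu gv u v : ℝ → ℝ}

lemma deriv01_neg (hp : 2 < p) (h : IsPosSol p N g u) {r : ℝ} (hr : r ∈ Ioc (0:ℝ) 1) :
    deriv01 u r < 0 := by
  have hanti : StrictAntiOn (flux p N u) (Icc 0 1) := by
    refine strictAntiOn_of_deriv_neg (convex_Icc 0 1) (continuousOn_flux hp N h.c1) fun s hs => ?_
    rw [interior_Icc] at hs
    rw [(h.eqn s hs).deriv]
    have := mul_pos (pow_pos hs.1 (N - 1)) (h.g_pos s hs)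
    linarith
  have := hanti ⟨le_rfl, zero_le_one⟩ ⟨hr.1.le, hr.2⟩ hr.1
  rw [flux_zero h.deriv_zero] at this
  exact deriv01_neg_of_flux_neg hr.1.le this

lemma strictAntiOn (hp : 2 < p) (h : IsPosSol p N g u) : StrictAntiOn u (Icc 0 1) :=
  strictAntiOn_of_deriv01_neg h.c1 fun _ hr => h.deriv01_neg hp hr

lemma tendsto_slope (h : IsPosSol p N g u) :
    Tendsto (fun r => u r / (1 - r)) (𝓝[<] 1) (𝓝 (-deriv01 u 1)) := by
  have h1 := (h.c1.hasDerivWithinAt ⟨zero_le_one, le_rfl⟩).mono Ico_subset_Icc_self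
  rw [hasDerivWithinAt_iff_tendsto_slope' (by simp), nhdsWithin_Ico_eq_nhdsLT zero_lt_one] at h1
  refine h1.neg.congr fun r => ?_
  rw [slope_def_field, h.map_one, sub_zero, ← div_neg, neg_sub]

end IsPosSol

/-- The function whose derivative is given by Picone's identity. -/
def piconeFun (p : ℝ) (N : ℕ) (u v : ℝ → ℝ) (r : ℝ) : ℝ :=
  flux p N u r * u r - flux p N v r * (u r * (u r / v r) ^ (p - 1))

namespace IsPosSol

variable {p : ℝ} {N : ℕ} {g gu gv u v : ℝ → ℝ}

lemma piconeFun_zero (hu : IsPosSol p N gu u) (hv : IsPosSol p N gv v) :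
    piconeFun p N u v 0 = 0 := by
  simp [piconeFun, flux_zero hu.deriv_zero, flux_zero hv.deriv_zero]

lemma continuousOn_piconeFun (hp : 2 < p) (hu : IsPosSol p N gu u) (hv : IsPosSol p N gv v) :
    ContinuousOn (piconeFun p N u v) (Ico 0 1) := by
  have hs : Ico (0:ℝ) 1 ⊆ Icc 0 1 := Ico_subset_Icc_self
  have hu' := hu.c1.continuousOn.mono hs
  have hv' := hv.c1.continuousOn.mono hs
  refine (((continuousOn_flux hp N hu.c1).mono hs).mul hu').sub
    (((continuousOn_flux hp N hv.c1).mono hs).mul (hu'.mul ?_))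
  exact (hu'.div hv' fun r hr => (hv.pos r hr).ne').rpow_const fun _ _ => Or.inr (by linarith)

lemma tendsto_piconeFun (hp : 2 < p) (hu : IsPosSol p N gu u) (hv : IsPosSol p N gv v) :
    Tendsto (piconeFun p N u v) (𝓝[<] 1) (𝓝 0) := by
  have lim : ∀ {k : ℝ → ℝ}, ContinuousOn k (Icc 0 1) → Tendsto k (𝓝[<] 1) (𝓝 (k 1)) := by
    intro k hk
    have := (hk 1 ⟨zero_le_one, le_rfl⟩).mono Ico_subset_Icc_self
    rwa [ContinuousWithinAt, nhdsWithin_Ico_eq_nhdsLT zero_lt_one] at this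
  have hv1 := hv.deriv01_neg hp (r := 1) ⟨zero_lt_one, le_rfl⟩
  have hq : Tendsto (fun r => u r / v r) (𝓝[<] 1) (𝓝 (-deriv01 u 1 / -deriv01 v 1)) := by
    refine (hu.tendsto_slope.div hv.tendsto_slope (by linarith)).congr' ?_
    filter_upwards [self_mem_nhdsWithin] with r hr
    have : (1 - r) ≠ 0 := by
      have : r < 1 := hr
      linarith
    exact div_div_div_cancel_right₀ this _ _
  have hu0 := lim hu.c1.continuousOn
  rw [hu.map_one] at hu0
  have hlim := ((lim (continuousOn_flux hp N hu.c1)).mul hu0).sub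
    ((lim (continuousOn_flux hp N hv.c1)).mul
      (hu0.mul (hq.rpow_const (p := p - 1) (Or.inr (by linarith)))))
  simp only [mul_zero, zero_mul, sub_zero] at hlim
  exact hlim

lemma exists_hasDerivAt_piconeFun (hp : 2 < p) (hu : IsPosSol p N gu u) (hv : IsPosSol p N gv v)
    {r : ℝ} (hr : r ∈ Ioo (0:ℝ) 1) :
    ∃ D, HasDerivAt (piconeFun p N u v) D r ∧
      r ^ (N - 1) * (gv r * (u r * (u r / v r) ^ (p - 1)) - gu r * u r) ≤ D := by
  have hu0 := hu.pos r (Ioo_subset_Ico_self hr)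
  have hv0 := hv.pos r (Ioo_subset_Ico_self hr)
  have hu1 := hu.deriv01_neg hp (Ioo_subset_Ioc_self hr)
  have hv1 := hv.deriv01_neg hp (Ioo_subset_Ioc_self hr)
  have hdu := hu.c1.hasDerivAt hr
  have hdv := hv.c1.hasDerivAt hr
  have hq0 : 0 < u r / v r := div_pos hu0 hv0
  refine ⟨_, ((hu.eqn r hr).mul hdu).sub ((hv.eqn r hr).mul
    (hdu.mul ((hdu.div hdv hv0.ne').rpow_const (p := p - 1) (Or.inl hq0.ne')))), ?_⟩
  simp only [Pi.div_apply]
  obtain ⟨x, hx⟩ : ∃ x, x = -deriv01 u r := ⟨_, rfl⟩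
  obtain ⟨y, hy⟩ : ∃ y, y = -deriv01 v r := ⟨_, rfl⟩
  obtain ⟨q, hq⟩ : ∃ q, q = u r / v r := ⟨_, rfl⟩
  have hx0 : 0 < x := by linarith
  have hy0 : 0 < y := by linarith
  have hux : deriv01 u r = -x := by linarith
  have hvy : deriv01 v r = -y := by linarith
  have huq : u r = q * v r := by rw [hq]; field_simp
  have hfu : flux p N u r = -(r ^ (N - 1) * x ^ (p - 1)) := by
    rw [flux, hux, phi_neg, phi_of_nonneg hp hx0.le]; ring
  have hfv : flux p N v r = -(r ^ (N - 1) * y ^ (p - 1)) := by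
    rw [flux, hvy, phi_neg, phi_of_nonneg hp hy0.le]; ring
  rw [← hq] at hq0 ⊢
  have hpow : ∀ {t : ℝ}, 0 < t → t ^ p = t ^ (p - 2) * t * t ∧ t ^ (p - 1) = t ^ (p - 2) * t := by
    intro t ht
    constructor
    · rw [← Real.rpow_add_one ht.ne', ← Real.rpow_add_one ht.ne']; congr 1; ring
    · rw [← Real.rpow_add_one ht.ne']; congr 1; ring
  have hY := picone_young hp hx0.le (mul_pos hq0 hy0).le
  rw [Real.mul_rpow hq0.le hy0.le, Real.mul_rpow hq0.le hy0.le, (hpow hx0).1, (hpow hq0).1,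
    (hpow hy0).1, (hpow hq0).2, (hpow hy0).2] at hY
  have hY' := mul_nonneg (pow_pos hr.1 (N - 1)).le hY
  rw [hfu, hfv, hux, hvy, huq, show p - 1 - 1 = p - 2 by ring, (hpow hx0).2, (hpow hy0).2,
    (hpow hq0).2]
  have hvr : v r ≠ 0 := hv0.ne'
  have e : (-x * v r - q * v r * -y) / v r ^ 2 = (q * y - x) / v r := by field_simp; ring
  rw [e]
  have e2 : q * v r * ((q * y - x) / v r * (p - 1) * q ^ (p - 2)) =
      q * ((q * y - x) * (p - 1) * q ^ (p - 2)) := by field_simp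
  rw [e2]
  nlinarith [hY']

lemma piconeFun_sub_ge (hp : 2 < p) (hu : IsPosSol p N gu u) (hv : IsPosSol p N gv v)
    {a b κ : ℝ} (ha : 0 ≤ a) (hab : a ≤ b) (hb : b < 1)
    (hκ : ∀ r ∈ Ioo a b, κ ≤ gv r * (u r * (u r / v r) ^ (p - 1)) - gu r * u r) :
    κ * (b ^ N - a ^ N) ≤ N * (piconeFun p N u v b - piconeFun p N u v a) := by
  have hsub : Ioo a b ⊆ Ioo 0 1 := fun r hr => ⟨ha.trans_lt hr.1, hr.2.trans hb⟩
  have hm : MonotoneOn (fun r => N * piconeFun p N u v r - κ * r ^ N) (Icc a b) := by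
    refine monotoneOn_of_deriv_nonneg (convex_Icc a b) ?_ ?_ ?_
    · refine (continuousOn_const.mul ((continuousOn_piconeFun hp hu hv).mono ?_)).sub (by fun_prop)
      exact fun r hr => ⟨ha.trans hr.1, hr.2.trans_lt hb⟩
    · intro r hr
      rw [interior_Icc] at hr
      obtain ⟨D, hD, -⟩ := exists_hasDerivAt_piconeFun hp hu hv (hsub hr)
      exact ((hD.const_mul (N:ℝ)).sub
        ((hasDerivAt_pow N r).const_mul κ)).differentiableAt.differentiableWithinAt
    · intro r hr
      rw [interior_Icc] at hr
      obtain ⟨D, hD, hDge⟩ := exists_hasDerivAt_piconeFun hp hu hv (hsub hr)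
      have hd : HasDerivAt (fun r => N * piconeFun p N u v r - κ * r ^ N)
          (N * D - κ * (N * r ^ (N - 1))) r :=
        (hD.const_mul (N:ℝ)).sub ((hasDerivAt_pow N r).const_mul κ)
      rw [hd.deriv]
      have h1 := mul_le_mul_of_nonneg_left (hκ r hr) (pow_pos (hsub hr).1 (N - 1)).le
      have h2 := mul_le_mul_of_nonneg_left (h1.trans hDge) (Nat.cast_nonneg (α := ℝ) N)
      linarith
  have := hm ⟨le_rfl, hab⟩ ⟨hab, le_rfl⟩ hab
  simp only at this
  linarith

/-- Sturm-type comparison: two positive solutions cannot have strictly ordered weights. -/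
lemma exists_weight_le (hp : 2 < p) (hu : IsPosSol p N gu u) (hv : IsPosSol p N gv v) :
    ∃ r ∈ Ioo (0:ℝ) 1, gv r * u r ^ (p - 1) ≤ gu r * v r ^ (p - 1) := by
  by_contra! hlt
  have hm : StrictMonoOn (piconeFun p N u v) (Ico 0 1) := by
    refine strictMonoOn_of_deriv_pos (convex_Ico 0 1) (continuousOn_piconeFun hp hu hv) ?_
    intro r hr
    rw [interior_Ico] at hr
    obtain ⟨D, hD, hDge⟩ := exists_hasDerivAt_piconeFun hp hu hv hr
    rw [hD.deriv]
    refine lt_of_lt_of_le (mul_pos (pow_pos hr.1 _) ?_) hDge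
    have hu0 := hu.pos r (Ioo_subset_Ico_self hr)
    have hv0 := Real.rpow_pos_of_pos (hv.pos r (Ioo_subset_Ico_self hr)) (p - 1)
    rw [Real.div_rpow hu0.le (hv.pos r (Ioo_subset_Ico_self hr)).le]
    have h1 : gu r < gv r * u r ^ (p - 1) / v r ^ (p - 1) := (lt_div_iff₀ hv0).2 (hlt r hr)
    have h2 := mul_lt_mul_of_pos_right h1 hu0
    rw [sub_pos]
    convert h2 using 1
    ring
  have h1 := hm ⟨le_rfl, zero_lt_one⟩ (show (1/2:ℝ) ∈ Ico (0:ℝ) 1 by norm_num) (by norm_num)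
  rw [piconeFun_zero hu hv] at h1
  have h2 : piconeFun p N u v (1/2) ≤ 0 := by
    refine ge_of_tendsto (tendsto_piconeFun hp hu hv) ?_
    filter_upwards [Ioo_mem_nhdsLT (show (1/2:ℝ) < 1 by norm_num)] with r hr
    exact hm.monotoneOn (by norm_num) ⟨by linarith [hr.1], hr.2⟩ hr.1.le
  linarith

end IsPosSol

namespace IsPosSol

variable {p : ℝ} {N : ℕ} {g u : ℝ → ℝ}

lemma zero_sub_le (hp : 2 < p) (hN : 1 ≤ N) (h : IsPosSol p N g u) {L : ℝ} (hL : 0 ≤ L)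
    (hg : ∀ r ∈ Ioo (0:ℝ) 1, g r ≤ L ^ (p - 1)) {r : ℝ} (hr : r ∈ Icc (0:ℝ) 1) :
    u 0 - L * r ≤ u r := by
  set K := L ^ (p - 1) with hK
  have hK0 : 0 ≤ K := Real.rpow_nonneg hL _
  have hm : MonotoneOn (fun r => flux p N u r + K * r ^ N) (Icc 0 1) := by
    have hd : ∀ r ∈ Ioo (0:ℝ) 1, HasDerivAt (fun r => flux p N u r + K * r ^ N)
        (-(r ^ (N - 1) * g r) + K * (N * r ^ (N - 1))) r := fun r hr =>
      (h.eqn r hr).add ((hasDerivAt_pow N r).const_mul K)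
    refine monotoneOn_of_deriv_nonneg (convex_Icc 0 1)
      ((continuousOn_flux hp N h.c1).add (by fun_prop)) ?_ ?_
    · intro r hr
      rw [interior_Icc] at hr
      exact (hd r hr).differentiableAt.differentiableWithinAt
    · intro r hr
      rw [interior_Icc] at hr
      rw [(hd r hr).deriv]
      have h1 : (1:ℝ) ≤ N := by exact_mod_cast hN
      have h2 := mul_le_mul_of_nonneg_left (hg r hr) (pow_pos hr.1 (N - 1)).le
      have h3 := mul_le_mul_of_nonneg_left h1 (mul_nonneg hK0 (pow_pos hr.1 (N - 1)).le)
      linarith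
  have hder : ∀ s ∈ Ioo (0:ℝ) 1, -L ≤ deriv01 u s := by
    intro s hs
    have h1 := hm ⟨le_rfl, zero_le_one⟩ (Ioo_subset_Icc_self hs) hs.1.le
    simp only [flux_zero h.deriv_zero, zero_pow (by omega : N ≠ 0)] at h1
    have hneg := h.deriv01_neg hp (Ioo_subset_Ioc_self hs)
    obtain ⟨x, hx⟩ : ∃ x, x = -deriv01 u s := ⟨_, rfl⟩
    have hux : deriv01 u s = -x := by linarith
    have hx0 : 0 ≤ x := by linarith
    have hpow : s ^ N = s ^ (N - 1) * s := by rw [← pow_succ]; congr 1; omega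
    rw [flux, hux, phi_neg, phi_of_nonneg hp hx0, hpow] at h1
    have h2 : s ^ (N - 1) * x ^ (p - 1) ≤ s ^ (N - 1) * (K * s) := by linarith
    have h3 := le_of_mul_le_mul_left h2 (pow_pos hs.1 _)
    have h4 : x ^ (p - 1) ≤ L ^ (p - 1) :=
      h3.trans (mul_le_of_le_one_right hK0 hs.2.le)
    have := (Real.rpow_le_rpow_iff hx0 hL (by linarith)).1 h4
    linarith
  have hm2 : MonotoneOn (fun r => u r + L * r) (Icc 0 1) := by
    have hd : ∀ r ∈ Ioo (0:ℝ) 1, HasDerivAt (fun r => u r + L * r) (deriv01 u r + L * 1) r :=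
      fun r hr => (h.c1.hasDerivAt hr).add ((hasDerivAt_id r).const_mul L)
    refine monotoneOn_of_deriv_nonneg (convex_Icc 0 1)
      (h.c1.continuousOn.add (by fun_prop)) ?_ ?_
    · intro r hr
      rw [interior_Icc] at hr
      exact (hd r hr).differentiableAt.differentiableWithinAt
    · intro r hr
      rw [interior_Icc] at hr
      rw [(hd r hr).deriv]
      linarith [hder r hr]
  have := hm2 ⟨le_rfl, zero_le_one⟩ hr hr.1
  simp only at this
  linarith

lemma norm0_eq (hp : 2 < p) (h : IsPosSol p N g u) : norm0 u = u 0 := by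
  have h0 := h.pos 0 ⟨le_rfl, zero_lt_one⟩
  refine IsGreatest.csSup_eq ⟨⟨0, ⟨le_rfl, zero_le_one⟩, abs_of_pos h0⟩, ?_⟩
  rintro _ ⟨r, hr, rfl⟩
  have ha := (h.strictAntiOn hp).antitoneOn
  have h1 := ha hr ⟨zero_le_one, le_rfl⟩ hr.2
  rw [h.map_one] at h1
  simp only [abs_of_nonneg h1]
  exact ha ⟨le_rfl, zero_le_one⟩ hr hr.1

lemma le_zero (hp : 2 < p) (h : IsPosSol p N g u) {r : ℝ} (hr : r ∈ Icc (0:ℝ) 1) :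
    u r ≤ u 0 :=
  (h.strictAntiOn hp).antitoneOn ⟨le_rfl, zero_le_one⟩ hr hr.1

end IsPosSol

lemma IsPrincipalEigenpair.isPosSol {p : ℝ} {N : ℕ} {w v : ℝ → ℝ} {lam : ℝ} (hp : 2 < p)
    (h : IsPrincipalEigenpair p N w lam v) (hw : ∀ r ∈ Icc (0:ℝ) 1, 0 < w r) :
    IsPosSol p N (fun r => lam * w r * v r ^ (p - 1)) v where
  c1 := h.2.1
  pos := h.2.2.2.1
  g_pos r hr := mul_pos (mul_pos h.1 (hw r (Ioo_subset_Icc_self hr)))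
    (Real.rpow_pos_of_pos (h.2.2.2.1 r (Ioo_subset_Ico_self hr)) _)
  eqn r hr := (h.2.2.2.2.1 r hr).congr_deriv <| by
    rw [phi_of_nonneg hp (h.2.2.2.1 r (Ioo_subset_Ico_self hr)).le]
    ring
  deriv_zero := h.2.2.2.2.2.1
  map_one := h.2.2.2.2.2.2

/-- A principal eigenvalue does not exist for the zero weight. -/
lemma not_isPrincipalEigenpair_zero {p : ℝ} {N : ℕ} {w v : ℝ → ℝ} {lam : ℝ} (hp : 2 < p)
    (hw : ∀ r ∈ Icc (0:ℝ) 1, w r = 0) : ¬ IsPrincipalEigenpair p N w lam v := by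
  rintro ⟨-, hc, -, hpos, heq, h0, h1⟩
  obtain ⟨c, hcI, hslope⟩ := exists_hasDerivAt_eq_slope v (deriv01 v) zero_lt_one
    hc.continuousOn fun r hr => hc.hasDerivAt hr
  have hneg : deriv01 v c < 0 := by
    rw [hslope, h1]
    linarith [hpos 0 ⟨le_rfl, zero_lt_one⟩]
  have hfc : flux p N v c < 0 := mul_neg_of_pos_of_neg (pow_pos hcI.1 _) (phi_neg_iff.2 hneg)
  obtain ⟨d, hd, hslope'⟩ := exists_hasDerivAt_eq_slope (flux p N v) (fun _ => 0) hcI.1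
    ((continuousOn_flux hp N hc).mono (Icc_subset_Icc_right hcI.2.le)) fun r hr => by
      have hr1 : r ∈ Ioo (0:ℝ) 1 := ⟨hr.1, hr.2.trans hcI.2⟩
      exact (heq r hr1).congr_deriv (by simp [hw r (Ioo_subset_Icc_self hr1)])
  rw [flux_zero h0, sub_zero, sub_zero] at hslope'
  exact (div_neg_of_neg_of_pos hfc hcI.1).ne hslope'.symm

namespace HypH

variable {p : ℝ} {N : ℕ} {f f₂ : ℝ → ℝ → ℝ} {f0 finf : ℝ → ℝ}

lemma antitoneOn_div (H : HypH p N f f₂ f0 finf) {r : ℝ} (hr : r ∈ Icc (0:ℝ) 1) :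
    AntitoneOn (fun ξ => f r ξ / ξ ^ (p - 1)) (Ioi 0) := by
  have hd : ∀ ξ ∈ Ioi (0:ℝ), HasDerivAt (fun ξ => f r ξ / ξ ^ (p - 1))
      ((f₂ r ξ * ξ ^ (p - 1) - f r ξ * (1 * (p - 1) * ξ ^ (p - 1 - 1))) / (ξ ^ (p - 1)) ^ 2) ξ :=
    fun ξ hξ => (H.hf_deriv r hr ξ).div
      ((hasDerivAt_id ξ).rpow_const (Or.inl (ne_of_gt hξ))) (Real.rpow_pos_of_pos hξ _).ne'
  refine antitoneOn_of_deriv_nonpos (convex_Ioi 0)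
    (fun ξ hξ => (hd ξ hξ).continuousAt.continuousWithinAt) ?_ ?_
  · intro ξ hξ
    rw [interior_Ioi] at hξ
    exact (hd ξ hξ).differentiableAt.differentiableWithinAt
  · intro ξ hξ
    rw [interior_Ioi] at hξ
    rw [(hd ξ hξ).deriv]
    refine div_nonpos_of_nonpos_of_nonneg ?_ (sq_nonneg _)
    have hξ0 : ξ ≠ 0 := ne_of_gt hξ
    have e : ξ ^ (p - 1) = ξ ^ (p - 1 - 1) * ξ := by
      rw [← Real.rpow_add_one hξ0]; congr 1; ring
    rw [e]
    have h1 := H.hH3 r hr ξ (le_of_lt hξ)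
    have h2 := mul_le_mul_of_nonneg_left h1 (Real.rpow_pos_of_pos hξ (p - 1 - 1)).le
    linarith

lemma le_f0_mul (H : HypH p N f f₂ f0 finf) {r ξ : ℝ} (hr : r ∈ Icc (0:ℝ) 1) (hξ : 0 < ξ) :
    f r ξ ≤ f0 r * ξ ^ (p - 1) := by
  rw [← div_le_iff₀ (Real.rpow_pos_of_pos hξ _)]
  refine le_of_forall_pos_le_add fun e he => ?_
  obtain ⟨d, hd, h⟩ := H.hH4a e he
  have hm : 0 < min (d / 2) ξ := lt_min (by linarith) hξ
  have h1 := h (min (d / 2) ξ) ⟨hm, (min_le_left _ _).trans_lt (by linarith)⟩ r hr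
  rw [phi_of_nonneg H.hp hm.le] at h1
  have h2 := H.antitoneOn_div hr hm hξ (min_le_right _ _)
  simp only at h2
  linarith [(abs_lt.1 h1).2]

lemma finf_mul_le (H : HypH p N f f₂ f0 finf) {r ξ : ℝ} (hr : r ∈ Icc (0:ℝ) 1) (hξ : 0 < ξ) :
    finf r * ξ ^ (p - 1) ≤ f r ξ := by
  rw [← le_div_iff₀ (Real.rpow_pos_of_pos hξ _)]
  refine le_of_forall_pos_le_add fun e he => ?_
  obtain ⟨M, h⟩ := H.hH5 e he
  have hm : 0 < max M ξ := lt_max_of_lt_right hξ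
  have h1 := h (max M ξ) (le_max_left _ _) r hr
  rw [phi_of_nonneg H.hp hm.le] at h1
  have h2 := H.antitoneOn_div hr hξ hm (le_max_right _ _)
  simp only at h2
  linarith [(abs_lt.1 h1).1]

lemma f0_pos (H : HypH p N f f₂ f0 finf) {r : ℝ} (hr : r ∈ Icc (0:ℝ) 1) : 0 < f0 r := by
  have := (H.hH2 r hr 1 one_ne_zero).trans_le (H.le_f0_mul hr one_pos)
  simpa using this

lemma nonneg (H : HypH p N f f₂ f0 finf) {r : ℝ} (hr : r ∈ Icc (0:ℝ) 1) (ξ : ℝ) :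
    0 ≤ f r ξ := by
  by_cases h : ξ = 0
  · rw [h, H.hf_zero r hr]
  · exact (H.hH2 r hr ξ h).le

/-- Nontrivial solutions with `λ > 0` are positive. -/
lemma isPosSol (H : HypH p N f f₂ f0 finf) {lam : ℝ} {u : ℝ → ℝ} (hlam : 0 < lam)
    (hu : IsSolutionP p N f lam u) (hnt : Nontriv01 u) :
    IsPosSol p N (fun r => lam * f r (u r)) u := by
  obtain ⟨hc, -, heq, h0, h1⟩ := hu
  have heqn : ∀ r ∈ Ioo (0:ℝ) 1, HasDerivAt (flux p N u)
      (-(r ^ (N - 1) * (lam * f r (u r)))) r := fun r hr =>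
    (heq r hr).congr_deriv (by ring)
  have hflux : AntitoneOn (flux p N u) (Icc 0 1) := by
    refine antitoneOn_of_deriv_nonpos (convex_Icc 0 1) (continuousOn_flux H.hp N hc) ?_ ?_
    · intro r hr
      rw [interior_Icc] at hr
      exact (heqn r hr).differentiableAt.differentiableWithinAt
    · intro r hr
      rw [interior_Icc] at hr
      rw [(heqn r hr).deriv, neg_nonpos]
      exact mul_nonneg (pow_nonneg hr.1.le _)
        (mul_nonneg hlam.le (H.nonneg (Ioo_subset_Icc_self hr) _))
  have hflux0 : ∀ r ∈ Icc (0:ℝ) 1, flux p N u r ≤ 0 := fun r hr => by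
    have := hflux ⟨le_rfl, zero_le_one⟩ hr hr.1
    rwa [flux_zero h0] at this
  have hanti : AntitoneOn u (Icc 0 1) := by
    refine antitoneOn_of_deriv_nonpos (convex_Icc 0 1) hc.continuousOn ?_ ?_
    · intro r hr
      rw [interior_Icc] at hr
      exact (hc.hasDerivAt hr).differentiableAt.differentiableWithinAt
    · intro r hr
      rw [interior_Icc] at hr
      rw [(hc.hasDerivAt hr).deriv]
      by_contra! hpos
      have hneg := hflux0 r (Ioo_subset_Icc_self hr)
      have : 0 < phi p (deriv01 u r) :=
        mul_pos (Real.rpow_pos_of_pos (abs_pos.2 hpos.ne') _) hpos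
      exact absurd (mul_pos (pow_pos hr.1 (N - 1)) this) (not_lt.2 hneg)
  have hu0 : 0 < u 0 := by
    obtain ⟨r, hr, hne⟩ := hnt
    have ha := hanti hr ⟨zero_le_one, le_rfl⟩ hr.2
    rw [h1] at ha
    exact (ha.lt_of_ne' hne).trans_le (hanti ⟨le_rfl, zero_le_one⟩ hr hr.1)
  have hfneg : ∀ r ∈ Ioc (0:ℝ) 1, flux p N u r < 0 := by
    intro r hr
    refine (hflux0 r ⟨hr.1.le, hr.2⟩).lt_of_ne fun hzero => hu0.ne' ?_
    have hf : ∀ s ∈ Ioo 0 r, flux p N u s = 0 := fun s hs => by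
      have hs1 : s ∈ Icc (0:ℝ) 1 := ⟨hs.1.le, hs.2.le.trans hr.2⟩
      refine le_antisymm (hflux0 s hs1) ?_
      rw [← hzero]
      exact hflux hs1 ⟨hr.1.le, hr.2⟩ hs.2.le
    have hus : ∀ s ∈ Ioo 0 r, u s = 0 := fun s hs => by
      have hs1 : s ∈ Ioo (0:ℝ) 1 := ⟨hs.1, hs.2.trans_le hr.2⟩
      have hd : HasDerivAt (flux p N u) 0 s :=
        (hasDerivAt_const s (0:ℝ)).congr_of_eventuallyEq
          (by filter_upwards [Ioo_mem_nhds hs.1 hs.2] with t ht using hf t ht)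
      have := (heqn s hs1).unique hd
      by_contra hne
      have h2 := mul_pos (pow_pos hs.1 (N - 1))
        (mul_pos hlam (H.hH2 s (Ioo_subset_Icc_self hs1) _ hne))
      linarith
    have hlim : Tendsto u (𝓝[>] 0) (𝓝 (u 0)) := by
      have := (hc.continuousOn 0 ⟨le_rfl, zero_le_one⟩).mono Ioc_subset_Icc_self
      rwa [ContinuousWithinAt, nhdsWithin_Ioc_eq_nhdsGT zero_lt_one] at this
    refine tendsto_nhds_unique hlim (tendsto_const_nhds.congr' ?_)
    filter_upwards [Ioo_mem_nhdsGT hr.1] with s hs using (hus s hs).symm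
  have hstrict := strictAntiOn_of_deriv01_neg hc fun r hr =>
    deriv01_neg_of_flux_neg hr.1.le (hfneg r hr)
  have hpos : ∀ r ∈ Ico (0:ℝ) 1, 0 < u r := fun r hr => by
    have := hstrict (Ico_subset_Icc_self hr) ⟨zero_le_one, le_rfl⟩ hr.2
    rwa [h1] at this
  exact ⟨hc, hpos, fun r hr => mul_pos hlam (H.hH2 r (Ioo_subset_Icc_self hr) _
    (hpos r (Ioo_subset_Ico_self hr)).ne'), heqn, h0, h1⟩

lemma exists_f0_le (H : HypH p N f f₂ f0 finf) :
    ∃ C > 0, ∀ r ∈ Icc (0:ℝ) 1, f0 r ≤ C := by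
  obtain ⟨x, hx, h⟩ := isCompact_Icc.exists_isMaxOn (nonempty_Icc.2 zero_le_one) H.hf0_cont
  exact ⟨f0 x, H.f0_pos hx, h⟩

lemma exists_le_of_pos {w : ℝ → ℝ} (hc : ContinuousOn w (Icc 0 1))
    (hw : ∀ r ∈ Icc (0:ℝ) 1, 0 < w r) : ∃ m > 0, ∀ r ∈ Icc (0:ℝ) 1, m ≤ w r := by
  obtain ⟨x, hx, h⟩ := isCompact_Icc.exists_isMinOn (nonempty_Icc.2 zero_le_one) hc
  exact ⟨w x, hw x hx, h⟩

lemma exists_le_finf_add (H : HypH p N f f₂ f0 finf) {e : ℝ} (he : 0 < e) :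
    ∃ M > 0, ∀ ξ, M ≤ ξ → ∀ r ∈ Icc (0:ℝ) 1, f r ξ ≤ (finf r + e) * ξ ^ (p - 1) := by
  obtain ⟨M, h⟩ := H.hH5 e he
  refine ⟨max M 1, lt_max_of_lt_right one_pos, fun ξ hξ r hr => ?_⟩
  have hξ0 : 0 < ξ := one_pos.trans_le ((le_max_right _ _).trans hξ)
  have h1 := h ξ ((le_max_left _ _).trans hξ) r hr
  rw [phi_of_nonneg H.hp hξ0.le] at h1
  rw [← div_le_iff₀ (Real.rpow_pos_of_pos hξ0 _)]
  linarith [(abs_lt.1 h1).2]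

lemma lam0_le (H : HypH p N f f₂ f0 finf) {lam0 lam : ℝ} {u v : ℝ → ℝ}
    (hv : IsPrincipalEigenpair p N f0 lam0 v) (hlam : 0 < lam)
    (hu : IsSolutionP p N f lam u) (hnt : Nontriv01 u) : lam0 ≤ lam := by
  have hu' := H.isPosSol hlam hu hnt
  obtain ⟨r, hr, h⟩ := hu'.exists_weight_le H.hp (hv.isPosSol H.hp fun r hr => H.f0_pos hr)
  have hr' := Ioo_subset_Icc_self hr
  have hur := hu'.pos r (Ioo_subset_Ico_self hr)
  have hvr := Real.rpow_pos_of_pos (hv.2.2.2.1 r (Ioo_subset_Ico_self hr)) (p - 1)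
  have hup := Real.rpow_pos_of_pos hur (p - 1)
  by_contra! hlt
  have h1 := mul_le_mul_of_nonneg_left (H.le_f0_mul hr' hur) hlam.le
  have h2 := mul_lt_mul_of_pos_right hlt (mul_pos (H.f0_pos hr') hup)
  have h3 := mul_lt_mul_of_pos_right (h1.trans_lt (by linarith :
    lam * (f0 r * u r ^ (p - 1)) < lam0 * (f0 r * u r ^ (p - 1)))) hvr
  linarith

lemma finf_pos (H : HypH p N f f₂ f0 finf) {lamInf : ℝ} {v : ℝ → ℝ}
    (hv : IsPrincipalEigenpair p N finf lamInf v) : ∀ r ∈ Icc (0:ℝ) 1, 0 < finf r :=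
  H.hH6.resolve_right fun h => not_isPrincipalEigenpair_zero H.hp h.2 hv

lemma le_lamInf (H : HypH p N f f₂ f0 finf) {lamInf lam : ℝ} {u v : ℝ → ℝ}
    (hv : IsPrincipalEigenpair p N finf lamInf v) (hlam : 0 < lam)
    (hu : IsSolutionP p N f lam u) (hnt : Nontriv01 u) : lam ≤ lamInf := by
  have hu' := H.isPosSol hlam hu hnt
  have hfinf := H.finf_pos hv
  obtain ⟨r, hr, h⟩ := (hv.isPosSol H.hp hfinf).exists_weight_le H.hp hu'
  have hr' := Ioo_subset_Icc_self hr
  have hur := hu'.pos r (Ioo_subset_Ico_self hr)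
  have hvr := Real.rpow_pos_of_pos (hv.2.2.2.1 r (Ioo_subset_Ico_self hr)) (p - 1)
  have hup := Real.rpow_pos_of_pos hur (p - 1)
  by_contra! hlt
  have h1 := mul_le_mul_of_nonneg_left (H.finf_mul_le hr' hur) hlam.le
  have h2 := mul_lt_mul_of_pos_right hlt (mul_pos (hfinf r hr') hup)
  have h3 := mul_lt_mul_of_pos_right (h2.trans_le h1) hvr
  linarith

lemma lam_lt_of_norm0_lt (H : HypH p N f f₂ f0 finf) {lam0 η : ℝ} {v : ℝ → ℝ}
    (hv : IsPrincipalEigenpair p N f0 lam0 v) (hη : 0 < η) :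
    ∃ d > 0, ∀ (lam : ℝ) (u : ℝ → ℝ), 0 < lam → IsSolutionP p N f lam u → Nontriv01 u →
      norm0 u < d → lam < lam0 + η := by
  obtain ⟨m, hm, hmle⟩ := exists_le_of_pos H.hf0_cont fun r hr => H.f0_pos hr
  have hl0 := hv.1
  obtain ⟨d, hd, hclose⟩ := H.hH4a (η * m / (lam0 + η)) (by positivity)
  refine ⟨d, hd, fun lam u hlam hu hnt hnorm => ?_⟩
  have hu' := H.isPosSol hlam hu hnt
  rw [hu'.norm0_eq H.hp] at hnorm
  obtain ⟨r, hr, h⟩ := (hv.isPosSol H.hp fun r hr => H.f0_pos hr).exists_weight_le H.hp hu'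
  have hr' := Ioo_subset_Icc_self hr
  have hur := hu'.pos r (Ioo_subset_Ico_self hr)
  have hvr := Real.rpow_pos_of_pos (hv.2.2.2.1 r (Ioo_subset_Ico_self hr)) (p - 1)
  have hup := Real.rpow_pos_of_pos hur (p - 1)
  by_contra! hle
  have h1 := (abs_lt.1 (hclose (u r) ⟨hur, (hu'.le_zero H.hp hr').trans_lt hnorm⟩ r hr')).1
  rw [phi_of_nonneg H.hp hur.le] at h1
  set a := f r (u r) / u r ^ (p - 1) with ha
  have hfa : f r (u r) = a * u r ^ (p - 1) := by rw [ha]; field_simp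
  have ha0 : 0 < a := div_pos (H.hH2 r hr' _ hur.ne') hup
  have h2 : (lam0 + η) * (f0 r - η * m / (lam0 + η)) = (lam0 + η) * f0 r - η * m := by
    field_simp
  have h3 := mul_lt_mul_of_pos_left (by linarith : f0 r - η * m / (lam0 + η) < a)
    (by linarith : 0 < lam0 + η)
  have h4 := mul_le_mul_of_nonneg_left (hmle r hr') hη.le
  have h5 := mul_le_mul_of_nonneg_right hle ha0.le
  have h6 : lam0 * f0 r < lam * a := by linarith
  have h7 := mul_lt_mul_of_pos_right h6 (mul_pos hup hvr)
  rw [hfa] at h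
  linarith

lemma lt_lam_of_lt_norm0_of_finf_zero (H : HypH p N f f₂ f0 finf)
    (hfinf : ∀ r ∈ Icc (0:ℝ) 1, finf r = 0) (Λ : ℝ) :
    ∃ R, ∀ (lam : ℝ) (u : ℝ → ℝ), 0 < lam → IsSolutionP p N f lam u → Nontriv01 u →
      R < norm0 u → Λ < lam := by
  wlog hΛ : 0 < Λ generalizing Λ
  · obtain ⟨R, hR⟩ := this 1 one_pos
    exact ⟨R, fun lam u h1 h2 h3 h4 => by linarith [hR lam u h1 h2 h3 h4]⟩
  obtain ⟨M, hM, hle⟩ := H.exists_le_finf_add (e := 1 / (2 * Λ)) (by positivity)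
  obtain ⟨C, hC, hC0⟩ := H.exists_f0_le
  have hp1 : 1 ≤ p - 1 := by linarith [H.hp]
  have hMp := Real.rpow_pos_of_pos hM (p - 1)
  refine ⟨max 1 (2 * (Λ * (C * M ^ (p - 1)))), fun lam u hlam hu hnt hnorm => ?_⟩
  have hu' := H.isPosSol hlam hu hnt
  rw [hu'.norm0_eq H.hp, max_lt_iff] at hnorm
  have hu0 : 0 < u 0 := by linarith
  have hup := Real.rpow_pos_of_pos hu0 (p - 1)
  by_contra! hlam'
  set K := Λ * (1 / (2 * Λ) * u 0 ^ (p - 1) + C * M ^ (p - 1)) with hK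
  have hK0 : 0 ≤ K := by positivity
  have hL0 : 0 ≤ K ^ (p - 1)⁻¹ := Real.rpow_nonneg hK0 _
  have hLp : (K ^ (p - 1)⁻¹) ^ (p - 1) = K := Real.rpow_inv_rpow hK0 (by linarith)
  have hb := hu'.zero_sub_le H.hp H.hN hL0 (r := 1) (fun r hr => by
    rw [hLp]
    have hr' := Ioo_subset_Icc_self hr
    have hur := hu'.pos r (Ioo_subset_Ico_self hr)
    refine mul_le_mul hlam' ?_ (H.nonneg hr' _) hΛ.le
    rcases le_total M (u r) with h | h
    · have h1 := hle (u r) h r hr'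
      rw [hfinf r hr', zero_add] at h1
      have h2 : u r ^ (p - 1) ≤ u 0 ^ (p - 1) :=
        Real.rpow_le_rpow hur.le (hu'.le_zero H.hp hr') (by linarith)
      have h3 := mul_le_mul_of_nonneg_left h2 (by positivity : 0 ≤ 1 / (2 * Λ))
      have h4 : 0 < C * M ^ (p - 1) := by positivity
      linarith
    · have h1 := H.le_f0_mul hr' hur
      have h2 : u r ^ (p - 1) ≤ M ^ (p - 1) := Real.rpow_le_rpow hur.le h (by linarith)
      have h3 := mul_le_mul (hC0 r hr') h2 (Real.rpow_nonneg hur.le _) hC.le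
      have h4 : 0 < 1 / (2 * Λ) * u 0 ^ (p - 1) := by positivity
      linarith) ⟨zero_le_one, le_rfl⟩
  rw [hu'.map_one] at hb
  have h1 : u 0 ^ (p - 1) ≤ K := by
    rw [← hLp]
    exact Real.rpow_le_rpow hu0.le (by linarith) (by linarith)
  have h2 : K = u 0 ^ (p - 1) / 2 + Λ * (C * M ^ (p - 1)) := by
    rw [hK]; field_simp
  have h3 : u 0 ≤ u 0 ^ (p - 1) := by
    simpa using Real.rpow_le_rpow_of_exponent_le hnorm.1.le hp1
  linarith [hnorm.2]

lemma lt_lam_of_lt_norm0 (H : HypH p N f f₂ f0 finf) {lamInf η : ℝ} {v : ℝ → ℝ}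
    (hv : IsPrincipalEigenpair p N finf lamInf v) (hη : 0 < η) :
    ∃ R, ∀ (lam : ℝ) (u : ℝ → ℝ), 0 < lam → IsSolutionP p N f lam u → Nontriv01 u →
      R < norm0 u → lamInf - η < lam := by
  have hfinf := H.finf_pos hv
  have hv' := hv.isPosSol H.hp hfinf
  have hl := hv.1
  have hp := H.hp
  obtain ⟨m, hm, hmle⟩ := exists_le_of_pos H.hfinf_cont hfinf
  obtain ⟨C, hC, hC0⟩ := H.exists_f0_le
  obtain ⟨M, hM, hle⟩ := H.exists_le_finf_add (e := η * m / (2 * lamInf)) (by positivity)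
  have hMp := Real.rpow_pos_of_pos hM (p - 1)
  have hlC : 0 < lamInf * C := by positivity
  set k := (lamInf * C) ^ (p - 1)⁻¹ with hk
  have hk0 : 0 < k := Real.rpow_pos_of_pos hlC _
  have hkp : k ^ (p - 1) = lamInf * C := Real.rpow_inv_rpow hlC.le (by linarith)
  set B := lamInf * (C * M ^ (p - 1)) * M with hB
  have hB0 : 0 < B := by positivity
  set ρ := 1 / (2 * (k + 1)) with hρ
  have hρ0 : 0 < ρ := by positivity
  have hρ1 : ρ < 1 := by
    rw [hρ, div_lt_one (by positivity)]
    linarith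
  have hkρ : k * ρ ≤ 1 / 2 := by
    rw [hρ, mul_one_div, div_le_div_iff₀ (by positivity) (by norm_num)]
    linarith
  have hρN : 0 < ρ ^ N := pow_pos hρ0 N
  refine ⟨2 + 2 * M + 4 * B / (η * m * ρ ^ N), fun lam u hlam hu hnt hnorm => ?_⟩
  have hu' := H.isPosSol hlam hu hnt
  rw [hu'.norm0_eq hp] at hnorm
  have hq0 : 0 < 4 * B / (η * m * ρ ^ N) := by positivity
  have hu0 : 0 < u 0 := by linarith
  by_contra! hle'
  have hlamle : lam ≤ lamInf := by linarith
  have hfb : ∀ r ∈ Ioo (0:ℝ) 1, lam * f r (u r) ≤ lamInf * (C * u r ^ (p - 1)) := by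
    intro r hr
    have hr' := Ioo_subset_Icc_self hr
    have hur := hu'.pos r (Ioo_subset_Ico_self hr)
    exact mul_le_mul hlamle ((H.le_f0_mul hr' hur).trans (mul_le_mul_of_nonneg_right (hC0 r hr')
      (Real.rpow_nonneg hur.le _))) (H.nonneg hr' _) hl.le
  have hlow : ∀ r ∈ Ioo (0:ℝ) ρ, u 0 / 2 ≤ u r := by
    intro r hr
    have hr' : r ∈ Icc (0:ℝ) 1 := ⟨hr.1.le, (hr.2.trans hρ1).le⟩
    have h1 := hu'.zero_sub_le hp H.hN (L := k * u 0) (by positivity) (fun s hs => by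
      rw [Real.mul_rpow hk0.le hu0.le, hkp, mul_assoc]
      refine (hfb s hs).trans (mul_le_mul_of_nonneg_left (mul_le_mul_of_nonneg_left
        (Real.rpow_le_rpow (hu'.pos s (Ioo_subset_Ico_self hs)).le
          (hu'.le_zero hp (Ioo_subset_Icc_self hs)) (by linarith)) hC.le) hl.le)) hr'
    have h2 := mul_le_mul_of_nonneg_right
      ((mul_le_mul_of_nonneg_left hr.2.le hk0.le).trans hkρ) hu0.le
    linarith
  have hrw : ∀ r ∈ Ioo (0:ℝ) 1,
      lamInf * finf r * v r ^ (p - 1) * (u r * (u r / v r) ^ (p - 1)) - lam * f r (u r) * u r =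
        (lamInf * finf r * u r ^ (p - 1) - lam * f r (u r)) * u r := by
    intro r hr
    have hur := hu'.pos r (Ioo_subset_Ico_self hr)
    have hvr := hv'.pos r (Ioo_subset_Ico_self hr)
    have hvp := Real.rpow_pos_of_pos hvr (p - 1)
    rw [Real.div_rpow hur.le hvr.le]
    field_simp
  have hlarge : ∀ r ∈ Ioo (0:ℝ) 1, M ≤ u r →
      η * m / 2 * u r ^ (p - 1) ≤ lamInf * finf r * u r ^ (p - 1) - lam * f r (u r) := by
    intro r hr hMr
    have hr' := Ioo_subset_Icc_self hr
    have hup := Real.rpow_pos_of_pos (hu'.pos r (Ioo_subset_Ico_self hr)) (p - 1)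
    have he : lamInf * (η * m / (2 * lamInf)) = η * m / 2 := by field_simp
    have h1 := mul_le_mul_of_nonneg_left (hle (u r) hMr r hr') hlam.le
    have he0 : 0 < η * m / (2 * lamInf) := by positivity
    have h2 : lam * (finf r + η * m / (2 * lamInf)) ≤ lamInf * finf r - η * m / 2 := by
      have h3 := mul_le_mul_of_nonneg_right hle' (hfinf r hr').le
      have h4 := mul_le_mul_of_nonneg_right hlamle he0.le
      have h5 := mul_le_mul_of_nonneg_left (hmle r hr') hη.le
      linarith
    have h3 := mul_le_mul_of_nonneg_right h2 hup.le
    linarith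
  have hstep1 := hu'.piconeFun_sub_ge hp hv' (a := 0) (b := ρ) (κ := η * m / 2 * (u 0 / 2))
    le_rfl hρ0.le hρ1 (fun r hr => by
      have hr1 : r ∈ Ioo (0:ℝ) 1 := ⟨hr.1, hr.2.trans hρ1⟩
      have hur := hlow r hr
      rw [hrw r hr1]
      have h1 := hlarge r hr1 (by linarith)
      have h2 : 1 ≤ u r ^ (p - 1) := Real.one_le_rpow (by linarith) (by linarith)
      have h3 := mul_le_mul_of_nonneg_left h2 (by positivity : 0 ≤ η * m / 2)
      exact mul_le_mul (by linarith) hur (by positivity)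
        (le_trans (by positivity) (h3.trans h1)))
  have hstep2 : ∀ b ∈ Ioo ρ 1,
      η * m / 2 * (u 0 / 2) * ρ ^ N - B ≤ N * piconeFun p N u v b := by
    intro b hb
    have h1 := hu'.piconeFun_sub_ge hp hv' (a := ρ) (b := b) (κ := -B)
      hρ0.le hb.1.le hb.2 (fun r hr => by
        have hr1 : r ∈ Ioo (0:ℝ) 1 := ⟨hρ0.trans hr.1, hr.2.trans hb.2⟩
        have hr' := Ioo_subset_Icc_self hr1
        have hur := hu'.pos r (Ioo_subset_Ico_self hr1)
        have hup := Real.rpow_pos_of_pos hur (p - 1)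
        rw [hrw r hr1]
        rcases le_total M (u r) with h | h
        · have h2 : 0 ≤ lamInf * finf r * u r ^ (p - 1) - lam * f r (u r) :=
            le_trans (by positivity) (hlarge r hr1 h)
          linarith [mul_nonneg h2 hur.le]
        · have h2 : u r ^ (p - 1) ≤ M ^ (p - 1) := Real.rpow_le_rpow hur.le h (by linarith)
          have h3 := mul_le_mul_of_nonneg_left
            (mul_le_mul_of_nonneg_left h2 hC.le) hl.le
          have h4 := mul_le_mul ((hfb r hr1).trans h3) h hur.le (by positivity)
          have h5 := mul_pos (mul_pos (mul_pos hl (hfinf r hr')) hup) hur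
          linarith)
    rw [hu'.piconeFun_zero hv', zero_pow (by have := H.hN; omega)] at hstep1
    have h2 : b ^ N ≤ 1 := pow_le_one₀ (hρ0.trans hb.1).le hb.2.le
    have h3 := mul_le_mul_of_nonneg_left (by linarith : b ^ N - ρ ^ N ≤ 1) hB0.le
    linarith
  have hlim := (hu'.tendsto_piconeFun hp hv').const_mul (N:ℝ)
  rw [mul_zero] at hlim
  have hfin := ge_of_tendsto hlim
    (by filter_upwards [Ioo_mem_nhdsLT hρ1] with b hb using hstep2 b hb)
  have hbig : 4 * B / (η * m * ρ ^ N) < u 0 := by linarith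
  rw [div_lt_iff₀ (by positivity)] at hbig
  linarith

end HypH

/-- under (H), (a) every nontrivial solution has `λ₀ ≤ λ ≤ λ∞`;
(b) `|uₙ|₀ → 0` forces `λₙ → λ₀`; (c) `|uₙ|₀ → ∞` forces `λₙ → λ∞` (resp. `λₙ → ∞`
when `f∞ ≡ 0` and `N = 1`). -/
theorem stmt_10 (p : ℝ) (N : ℕ) (f f₂ : ℝ → ℝ → ℝ) (f0 finf : ℝ → ℝ)
    (H : HypH p N f f₂ f0 finf)
    (lam0 : ℝ) (hlam0 : ∃ v, IsPrincipalEigenpair p N f0 lam0 v) :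
    -- (a) lower bound
    (∀ (lam : ℝ) (u : ℝ → ℝ), 0 < lam → IsSolutionP p N f lam u → Nontriv01 u →
      lam0 ≤ lam) ∧
    -- (a) upper bound when f∞ has a principal eigenvalue
    (∀ lamInf : ℝ, (∃ v, IsPrincipalEigenpair p N finf lamInf v) →
      ∀ (lam : ℝ) (u : ℝ → ℝ), 0 < lam → IsSolutionP p N f lam u → Nontriv01 u →
        lam ≤ lamInf) ∧
    -- (b)
    (∀ (lamn : ℕ → ℝ) (un : ℕ → ℝ → ℝ),
      (∀ n, 0 < lamn n) → (∀ n, IsSolutionP p N f (lamn n) (un n)) →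
      (∀ n, Nontriv01 (un n)) →
      Filter.Tendsto (fun n => norm0 (un n)) Filter.atTop (nhds 0) →
      Filter.Tendsto lamn Filter.atTop (nhds lam0)) ∧
    -- (c) case f∞ > 0
    (∀ lamInf : ℝ, (∃ v, IsPrincipalEigenpair p N finf lamInf v) →
      ∀ (lamn : ℕ → ℝ) (un : ℕ → ℝ → ℝ),
        (∀ n, 0 < lamn n) → (∀ n, IsSolutionP p N f (lamn n) (un n)) →
        (∀ n, Nontriv01 (un n)) →
        Filter.Tendsto (fun n => norm0 (un n)) Filter.atTop Filter.atTop →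
        Filter.Tendsto lamn Filter.atTop (nhds lamInf)) ∧
    -- (c) case f∞ ≡ 0, N = 1
    ((N = 1 ∧ ∀ r ∈ Set.Icc (0:ℝ) 1, finf r = 0) →
      ∀ (lamn : ℕ → ℝ) (un : ℕ → ℝ → ℝ),
        (∀ n, 0 < lamn n) → (∀ n, IsSolutionP p N f (lamn n) (un n)) →
        (∀ n, Nontriv01 (un n)) →
        Filter.Tendsto (fun n => norm0 (un n)) Filter.atTop Filter.atTop →
        Filter.Tendsto lamn Filter.atTop Filter.atTop) := by
  obtain ⟨v0, hv0⟩ := hlam0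
  refine ⟨fun lam u h1 h2 h3 => H.lam0_le hv0 h1 h2 h3,
    fun lamInf ⟨v, hv⟩ lam u h1 h2 h3 => H.le_lamInf hv h1 h2 h3, ?_, ?_, ?_⟩
  · intro lamn un hpos hsol hnt hlim
    refine tendsto_order.2 ⟨fun a ha => Eventually.of_forall fun n =>
      ha.trans_le (H.lam0_le hv0 (hpos n) (hsol n) (hnt n)), fun b hb => ?_⟩
    obtain ⟨d, hd, h⟩ := H.lam_lt_of_norm0_lt hv0 (sub_pos.2 hb)
    filter_upwards [hlim.eventually (gt_mem_nhds hd)] with n hn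
    linarith [h _ _ (hpos n) (hsol n) (hnt n) hn]
  · rintro lamInf ⟨v, hv⟩ lamn un hpos hsol hnt hlim
    refine tendsto_order.2 ⟨fun a ha => ?_, fun b hb => Eventually.of_forall fun n =>
      (H.le_lamInf hv (hpos n) (hsol n) (hnt n)).trans_lt hb⟩
    obtain ⟨R, h⟩ := H.lt_lam_of_lt_norm0 hv (sub_pos.2 ha)
    filter_upwards [hlim.eventually_gt_atTop R] with n hn
    linarith [h _ _ (hpos n) (hsol n) (hnt n) hn]
  · rintro ⟨-, hfinf⟩ lamn un hpos hsol hnt hlim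
    refine tendsto_atTop.2 fun Λ => ?_
    obtain ⟨R, h⟩ := H.lt_lam_of_lt_norm0_of_finf_zero hfinf Λ
    filter_upwards [hlim.eventually_gt_atTop R] with n hn
    exact (h _ _ (hpos n) (hsol n) (hnt n) hn).le
end
end

section
/- Assume hypotheses (H'), let λ_0 be a principal eigenvalue for the weight f_0, and let λ_∞ be a principal eigenvalue for the weight f_∞ if f_∞>0 on [0,1], while λ_∞:=+∞ if f_∞≡0 (and N=1). Then: (a) every nontrivial solution (λ,u) of (P) with λ>0 and with u≥0 on [0,1] or u≤0 on [0,1] satisfies λ_0≤λ≤λ_∞; (b) if (λ_n,u_n) is a sequence of such sign-definite nontrivial solutions with λ_n>0 and |u_n|_0→0, then λ_n→λ_0; (c) if instead |u_n|_0→∞, then λ_n→λ_∞ when f_∞>0 on [0,1], and λ_n→∞ when f_∞≡0 and N=1. -/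
open Set MeasureTheory Filter Topology intervalIntegral

noncomputable section

/-- Hypotheses (H') of the paper: (H1), (H2')–(H5'), (H6). -/
structure HypH' (p : ℝ) (N : ℕ) (f f₂ : ℝ → ℝ → ℝ) (f0 finf : ℝ → ℝ) : Prop where
  hp : 2 < p
  hN : 1 ≤ N
  hf_cont : ContinuousOn (fun q : ℝ × ℝ => f q.1 q.2) (Set.Icc 0 1 ×ˢ Set.univ)
  hf_deriv : ∀ r ∈ Set.Icc (0:ℝ) 1, ∀ ξ : ℝ, HasDerivAt (fun t => f r t) (f₂ r ξ) ξ
  hf₂_cont : ContinuousOn (fun q : ℝ × ℝ => f₂ q.1 q.2) (Set.Icc 0 1 ×ˢ Set.univ)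
  hH2 : ∀ r ∈ Set.Icc (0:ℝ) 1, ∀ ξ : ℝ, ξ ≠ 0 → 0 < f r ξ * ξ
  hf_zero : ∀ r ∈ Set.Icc (0:ℝ) 1, f r 0 = 0
  hH3p : ∀ r ∈ Set.Icc (0:ℝ) 1, ∀ ξ : ℝ, 0 ≤ ξ → f₂ r ξ * ξ ≤ (p - 1) * f r ξ
  hH3m : ∀ r ∈ Set.Icc (0:ℝ) 1, ∀ ξ : ℝ, ξ ≤ 0 → (p - 1) * f r ξ ≤ f₂ r ξ * ξ
  hH3s : ∃ δ > 0, ∃ ε > 0, ∀ r ∈ Set.Ioc (1 - δ) 1, ∀ ξ : ℝ, ξ ≠ 0 → |ξ| < ε →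
      (0 < ξ → f₂ r ξ * ξ < (p - 1) * f r ξ) ∧ (ξ < 0 → (p - 1) * f r ξ < f₂ r ξ * ξ)
  hf0_cont : ContinuousOn f0 (Set.Icc 0 1)
  hfinf_cont : ContinuousOn finf (Set.Icc 0 1)
  hH4a : ∀ e > 0, ∃ d > 0, ∀ ξ : ℝ, ξ ≠ 0 → |ξ| < d → ∀ r ∈ Set.Icc (0:ℝ) 1,
      |f r ξ / phi p ξ - f0 r| < e
  hH4b : ∀ e > 0, ∃ d > 0, ∀ ξ : ℝ, ξ ≠ 0 → |ξ| < d → ∀ r ∈ Set.Icc (0:ℝ) 1,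
      |f₂ r ξ / |ξ| ^ (p - 2) - (p - 1) * f0 r| < e
  hH5 : ∀ e > 0, ∃ M : ℝ, ∀ ξ : ℝ, M ≤ |ξ| → ∀ r ∈ Set.Icc (0:ℝ) 1,
      |f r ξ / phi p ξ - finf r| < e
  hH6 : (∀ r ∈ Set.Icc (0:ℝ) 1, 0 < finf r) ∨ (N = 1 ∧ ∀ r ∈ Set.Icc (0:ℝ) 1, finf r = 0)

/-- `u` is sign-definite on `[0,1]`: everywhere `≥ 0` or everywhere `≤ 0`. -/
def SignDef (u : ℝ → ℝ) : Prop :=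
  (∀ r ∈ Set.Icc (0:ℝ) 1, 0 ≤ u r) ∨ (∀ r ∈ Set.Icc (0:ℝ) 1, u r ≤ 0)

section PhiLemmas

lemma phi_zero (p : ℝ) : phi p 0 = 0 := by simp [phi]

lemma phi_pos {p x : ℝ} (hx : 0 < x) : 0 < phi p x :=
  mul_pos (Real.rpow_pos_of_pos (abs_pos.2 hx.ne') _) hx

lemma phi_of_pos {p x : ℝ} (hx : 0 < x) : phi p x = x ^ (p - 1) := by
  rw [phi, abs_of_pos hx, ← Real.rpow_add_one hx.ne']
  ring_nf

lemma phi_ne_zero {p x : ℝ} (hx : x ≠ 0) : phi p x ≠ 0 :=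
  mul_ne_zero (Real.rpow_pos_of_pos (abs_pos.2 hx) _).ne' hx

lemma abs_phi {p : ℝ} (hp : 2 < p) (x : ℝ) : |phi p x| = |x| ^ (p - 1) := by
  rcases eq_or_ne x 0 with rfl | hx
  · rw [phi_zero, abs_zero, Real.zero_rpow (by linarith)]
  · rw [phi, abs_mul, abs_of_nonneg (by positivity), ← Real.rpow_add_one (abs_pos.2 hx).ne']
    ring_nf

lemma phi_mul_self {p : ℝ} (hp : 2 < p) (x : ℝ) : phi p x * x = |x| ^ p := by
  rcases eq_or_ne x 0 with rfl | hx
  · rw [mul_zero, abs_zero, Real.zero_rpow (by linarith)]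
  · rw [phi, mul_assoc, ← abs_mul_abs_self, ← mul_assoc,
      ← Real.rpow_add_one (abs_pos.2 hx).ne', ← Real.rpow_add_one (abs_pos.2 hx).ne']
    ring_nf

lemma phi_nonpos_iff {p x : ℝ} : phi p x ≤ 0 ↔ x ≤ 0 := by
  constructor
  · intro h
    by_contra! hx
    exact absurd (phi_pos (p := p) hx) h.not_gt
  · intro h
    exact mul_nonpos_of_nonneg_of_nonpos (by positivity) h

/-- The pointwise inequality behind Picone's identity. -/
lemma picone_nonneg {p : ℝ} (hp : 2 < p) (x y : ℝ) {R : ℝ} (hR : 0 < R) :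
    0 ≤ phi p x * x - phi p y * (p * x * R ^ (p - 1) - (p - 1) * R ^ p * y) := by
  have hpq : p.HolderConjugate (p / (p - 1)) := Real.HolderConjugate.conjExponent (by linarith)
  have hY := Real.young_inequality_of_nonneg (abs_nonneg x)
    (Real.rpow_nonneg (mul_nonneg hR.le (abs_nonneg y)) (p - 1)) hpq
  have h1 : ((R * |y|) ^ (p - 1)) ^ (p / (p - 1)) = R ^ p * |y| ^ p := by
    rw [← Real.rpow_mul (by positivity), mul_div_cancel₀ _ (by linarith),
      Real.mul_rpow hR.le (abs_nonneg y)]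
  rw [h1, Real.mul_rpow hR.le (abs_nonneg y)] at hY
  have h2 : p * (|x| * (R ^ (p - 1) * |y| ^ (p - 1))) ≤ |x| ^ p + (p - 1) * (R ^ p * |y| ^ p) := by
    have := mul_le_mul_of_nonneg_left hY (by linarith : (0:ℝ) ≤ p)
    have hp0 : p ≠ 0 := by linarith
    have hp1 : p - 1 ≠ 0 := by linarith
    have e : p * (|x| ^ p / p + R ^ p * |y| ^ p / (p / (p - 1)))
        = |x| ^ p + (p - 1) * (R ^ p * |y| ^ p) := by
      field_simp
    rwa [e] at this
  have h3 : phi p y * x ≤ |x| * |y| ^ (p - 1) := by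
    rw [← abs_phi hp, mul_comm |x|, ← abs_mul]
    exact le_abs_self _
  have h4 : 0 ≤ p * R ^ (p - 1) := by positivity
  have h5 := mul_le_mul_of_nonneg_left h3 h4
  have e1 := phi_mul_self hp x
  have e2 := phi_mul_self hp y
  have : phi p x * x - phi p y * (p * x * R ^ (p - 1) - (p - 1) * R ^ p * y)
      = |x| ^ p + (p - 1) * (R ^ p * |y| ^ p) - p * R ^ (p - 1) * (phi p y * x) := by
    rw [← e1, ← e2]; ring
  rw [this]
  linarith

end PhiLemmas

section Calculus

lemma le_of_hasDerivAt_nonneg {F F' : ℝ → ℝ} {x y : ℝ} (hxy : x ≤ y)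
    (hc : ContinuousOn F (Icc x y)) (hd : ∀ r ∈ Ioo x y, HasDerivAt F (F' r) r)
    (h0 : ∀ r ∈ Ioo x y, 0 ≤ F' r) : F x ≤ F y := by
  refine monotoneOn_of_deriv_nonneg (convex_Icc x y) hc ?_ ?_ (left_mem_Icc.2 hxy)
    (right_mem_Icc.2 hxy) hxy
  · rw [interior_Icc]
    exact fun r hr => (hd r hr).differentiableAt.differentiableWithinAt
  · rw [interior_Icc]
    exact fun r hr => (hd r hr).deriv ▸ h0 r hr

lemma lt_of_hasDerivAt_pos {F F' : ℝ → ℝ} {x y : ℝ} (hxy : x < y)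
    (hc : ContinuousOn F (Icc x y)) (hd : ∀ r ∈ Ioo x y, HasDerivAt F (F' r) r)
    (h0 : ∀ r ∈ Ioo x y, 0 < F' r) : F x < F y := by
  refine strictMonoOn_of_deriv_pos (convex_Icc x y) hc ?_ (left_mem_Icc.2 hxy.le)
    (right_mem_Icc.2 hxy.le) hxy
  rw [interior_Icc]
  exact fun r hr => (hd r hr).deriv ▸ h0 r hr

/-- Integrating the inequality `F' ≥ κ r ^ (N - 1)`. -/
lemma add_le_of_hasDerivAt_ge {F F' : ℝ → ℝ} {x y κ : ℝ} {N : ℕ} (hN : 1 ≤ N) (hxy : x ≤ y)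
    (hc : ContinuousOn F (Icc x y)) (hd : ∀ r ∈ Ioo x y, HasDerivAt F (F' r) r)
    (h0 : ∀ r ∈ Ioo x y, κ * r ^ (N - 1) ≤ F' r) :
    F x + κ / N * (y ^ N - x ^ N) ≤ F y := by
  have hN0 : (N : ℝ) ≠ 0 := by positivity
  have := le_of_hasDerivAt_nonneg (F := fun r => F r - κ / N * r ^ N)
    (F' := fun r => F' r - κ / N * (N * r ^ (N - 1))) hxy (by fun_prop)
    (fun r hr => (hd r hr).sub ((hasDerivAt_pow N r).const_mul _))
    (fun r hr => by
      have := h0 r hr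
      have e : κ / N * (N * r ^ (N - 1)) = κ * r ^ (N - 1) := by field_simp
      simp only [e]
      linarith)
  linarith

lemma C1on01.neg {u : ℝ → ℝ} (hu : C1on01 u) : C1on01 (fun r => -u r) := by
  refine ⟨fun r hr => (hu.1 r hr).neg, ?_⟩
  have : deriv01 (fun r => -u r) = fun r => -deriv01 u r := by
    funext r
    exact derivWithin.fun_neg
  rw [this]
  exact hu.2.neg

end Calculus

section RadialMonotonicity

variable {p : ℝ} {N : ℕ} {u h : ℝ → ℝ}

lemma continuousOn_flux_s11 (hp : 2 < p) (hu : C1on01 u) :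
    ContinuousOn (fun s => s ^ (N - 1) * phi p (deriv01 u s)) (Icc 0 1) :=
  (continuous_pow _).continuousOn.mul ((continuous_phi hp).comp_continuousOn hu.2)

lemma flux_zero_s11 (h0 : deriv01 u 0 = 0) : (0:ℝ) ^ (N - 1) * phi p (deriv01 u 0) = 0 := by
  rw [h0, phi_zero, mul_zero]

lemma flux_antitone (hp : 2 < p) (hu : C1on01 u)
    (hd : ∀ r ∈ Ioo (0:ℝ) 1, HasDerivAt (fun s => s ^ (N - 1) * phi p (deriv01 u s))
      (-(r ^ (N - 1) * h r)) r)
    (hh : ∀ r ∈ Ioo (0:ℝ) 1, 0 ≤ h r) {x y : ℝ} (hx : 0 ≤ x) (hxy : x ≤ y) (hy : y ≤ 1) :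
    y ^ (N - 1) * phi p (deriv01 u y) ≤ x ^ (N - 1) * phi p (deriv01 u x) := by
  have hsub : Icc x y ⊆ Icc 0 1 := Icc_subset_Icc hx hy
  have := le_of_hasDerivAt_nonneg (F := fun s => -(s ^ (N - 1) * phi p (deriv01 u s)))
    (F' := fun r => r ^ (N - 1) * h r) hxy
    (((continuousOn_flux_s11 hp hu).mono hsub).neg)
    (fun r hr => by
      simpa using (hd r ⟨hx.trans_lt hr.1, hr.2.trans_le hy⟩).fun_neg)
    (fun r hr => mul_nonneg (pow_nonneg (hx.trans hr.1.le) _)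
      (hh r ⟨hx.trans_lt hr.1, hr.2.trans_le hy⟩))
  simpa using this

lemma deriv01_nonpos (hp : 2 < p) (hu : C1on01 u)
    (hd : ∀ r ∈ Ioo (0:ℝ) 1, HasDerivAt (fun s => s ^ (N - 1) * phi p (deriv01 u s))
      (-(r ^ (N - 1) * h r)) r)
    (hh : ∀ r ∈ Ioo (0:ℝ) 1, 0 ≤ h r) (h0 : deriv01 u 0 = 0) {r : ℝ} (hr : r ∈ Icc (0:ℝ) 1) :
    deriv01 u r ≤ 0 := by
  rcases hr.1.eq_or_lt with rfl | hr0
  · exact h0.le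
  · have := flux_antitone hp hu hd hh le_rfl hr.1 hr.2
    rw [flux_zero_s11 h0] at this
    exact phi_nonpos_iff.1 (nonpos_of_mul_nonpos_right this (by positivity))

lemma radial_antitone (hp : 2 < p) (hu : C1on01 u)
    (hd : ∀ r ∈ Ioo (0:ℝ) 1, HasDerivAt (fun s => s ^ (N - 1) * phi p (deriv01 u s))
      (-(r ^ (N - 1) * h r)) r)
    (hh : ∀ r ∈ Ioo (0:ℝ) 1, 0 ≤ h r) (h0 : deriv01 u 0 = 0) : AntitoneOn u (Icc 0 1) := by
  intro x hx y hy hxy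
  have := le_of_hasDerivAt_nonneg (F := fun s => -u s) (F' := fun s => -deriv01 u s) hxy
    ((hu.continuousOn.mono (Icc_subset_Icc hx.1 hy.2)).neg)
    (fun r hr => (hu.hasDerivAt ⟨hx.1.trans_lt hr.1, hr.2.trans_le hy.2⟩).neg)
    (fun r hr => neg_nonneg.2
      (deriv01_nonpos hp hu hd hh h0 ⟨hx.1.trans hr.1.le, hr.2.le.trans hy.2⟩))
  simpa using this

lemma deriv01_one_neg (hp : 2 < p) (hu : C1on01 u)
    (hd : ∀ r ∈ Ioo (0:ℝ) 1, HasDerivAt (fun s => s ^ (N - 1) * phi p (deriv01 u s))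
      (-(r ^ (N - 1) * h r)) r)
    (hh : ∀ r ∈ Ioo (0:ℝ) 1, 0 < h r) (h0 : deriv01 u 0 = 0) : deriv01 u 1 < 0 := by
  have := lt_of_hasDerivAt_pos (F := fun s => -(s ^ (N - 1) * phi p (deriv01 u s)))
    (F' := fun r => r ^ (N - 1) * h r) zero_lt_one
    ((continuousOn_flux_s11 hp hu).neg)
    (fun r hr => by simpa using (hd r hr).fun_neg)
    (fun r hr => mul_pos (pow_pos hr.1 _) (hh r hr))
  simp only [flux_zero_s11 h0, one_pow, one_mul] at this
  by_contra! hc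
  rcases hc.eq_or_lt with he | hl
  · rw [← he, phi_zero] at this
    exact lt_irrefl _ this
  · linarith [phi_pos (p := p) hl]

/-- Strong maximum principle for radial solutions. -/
lemma radial_pos (hp : 2 < p) (hu : C1on01 u)
    (hd : ∀ r ∈ Ioo (0:ℝ) 1, HasDerivAt (fun s => s ^ (N - 1) * phi p (deriv01 u s))
      (-(r ^ (N - 1) * h r)) r)
    (hh : ∀ r ∈ Ioo (0:ℝ) 1, 0 ≤ h r) (hpos : ∀ r ∈ Ioo (0:ℝ) 1, 0 < u r → 0 < h r)
    (h0 : deriv01 u 0 = 0) (hnn : ∀ r ∈ Icc (0:ℝ) 1, 0 ≤ u r)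
    (hnt : Nontriv01 u) : ∀ r ∈ Ico (0:ℝ) 1, 0 < u r := by
  have hanti := radial_antitone hp hu hd hh h0
  have hu0 : 0 < u 0 := by
    obtain ⟨r, hr, hne⟩ := hnt
    exact ((hnn r hr).lt_of_ne' hne).trans_le (hanti (by simp) hr hr.1)
  intro r hr
  rcases hr.1.eq_or_lt with rfl | hr0
  · exact hu0
  by_contra! hle
  have hur : u r = 0 := le_antisymm hle (hnn r ⟨hr.1, hr.2.le⟩)
  have hmin : IsLocalMin u r := by
    filter_upwards [Icc_mem_nhds hr0 hr.2] with s hs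
    rw [hur]
    exact hnn s hs
  have hder : deriv01 u r = 0 := hmin.hasDerivAt_eq_zero (hu.hasDerivAt ⟨hr0, hr.2⟩)
  have hflux : ∀ s ∈ Ioo 0 r, s ^ (N - 1) * phi p (deriv01 u s) = 0 := by
    intro s hs
    refine le_antisymm ?_ ?_
    · simpa [flux_zero_s11 h0] using
        flux_antitone hp hu hd hh le_rfl hs.1.le (hs.2.le.trans hr.2.le)
    · simpa [hder, phi_zero] using flux_antitone hp hu hd hh hs.1.le hs.2.le hr.2.le
  have hzero : ∀ s ∈ Ioo 0 r, u s = 0 := by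
    intro s hs
    have hs1 : s ∈ Ioo (0:ℝ) 1 := ⟨hs.1, hs.2.trans hr.2⟩
    have h1 : HasDerivAt (fun s => s ^ (N - 1) * phi p (deriv01 u s)) 0 s :=
      (hasDerivAt_const s (0:ℝ)).congr_of_eventuallyEq
        (by filter_upwards [Ioo_mem_nhds hs.1 hs.2] with t ht using hflux t ht)
    have h2 := (hd s hs1).unique h1
    have h3 : s ^ (N - 1) * h s = 0 := by linarith
    rcases mul_eq_zero.1 h3 with h4 | h4
    · exact absurd h4 (pow_pos hs.1 _).ne'
    · by_contra hne
      exact (hpos s hs1 ((hnn s (Ioo_subset_Icc_self hs1)).lt_of_ne' hne)).ne' h4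
  have hlim : Tendsto u (𝓝[>] 0) (𝓝 (u 0)) :=
    ((hu.continuousOn 0 (by simp)).mono_of_mem_nhdsWithin
      (Icc_mem_nhdsGT zero_lt_one)).tendsto
  have hlim0 : Tendsto u (𝓝[>] 0) (𝓝 0) :=
    tendsto_const_nhds.congr' (by
      filter_upwards [Ioo_mem_nhdsGT hr0] with s hs using (hzero s hs).symm)
  exact hu0.ne' (tendsto_nhds_unique hlim hlim0)

end RadialMonotonicity

section Eigenpairs

variable {p : ℝ} {N : ℕ} {a b u v : ℝ → ℝ} {lam mu : ℝ}

lemma IsPrincipalEigenpair.hasDerivAt_flux (hu : IsPrincipalEigenpair p N a lam u) :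
    ∀ r ∈ Ioo (0:ℝ) 1, HasDerivAt (fun s => s ^ (N - 1) * phi p (deriv01 u s))
      (-(r ^ (N - 1) * (lam * a r * u r ^ (p - 1)))) r := by
  intro r hr
  convert hu.2.2.2.2.1 r hr using 1
  rw [phi_of_pos (hu.2.2.2.1 r ⟨hr.1.le, hr.2⟩)]
  ring

lemma IsPrincipalEigenpair.antitoneOn (hp : 2 < p) (hu : IsPrincipalEigenpair p N a lam u)
    (ha : ∀ r ∈ Ioo (0:ℝ) 1, 0 < a r) : AntitoneOn u (Icc 0 1) :=
  radial_antitone hp hu.2.1 hu.hasDerivAt_flux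
    (fun r hr => mul_nonneg (mul_nonneg hu.1.le (ha r hr).le)
      (Real.rpow_nonneg (hu.2.2.2.1 r ⟨hr.1.le, hr.2⟩).le _)) hu.2.2.2.2.2.1

lemma IsPrincipalEigenpair.deriv01_one_neg (hp : 2 < p) (hu : IsPrincipalEigenpair p N a lam u)
    (ha : ∀ r ∈ Ioo (0:ℝ) 1, 0 < a r) : deriv01 u 1 < 0 :=
  _root_.deriv01_one_neg hp hu.2.1 hu.hasDerivAt_flux
    (fun r hr => mul_pos (mul_pos hu.1 (ha r hr))
      (Real.rpow_pos_of_pos (hu.2.2.2.1 r ⟨hr.1.le, hr.2⟩) _)) hu.2.2.2.2.2.1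

lemma tendsto_div_at_one (hu : C1on01 u) (hv : C1on01 v) (hu1 : u 1 = 0) (hv1 : v 1 = 0)
    (hv' : deriv01 v 1 ≠ 0) :
    Tendsto (fun r => u r / v r) (𝓝[Icc 0 1 \ {1}] 1) (𝓝 (deriv01 u 1 / deriv01 v 1)) := by
  have h1 := hasDerivWithinAt_iff_tendsto_slope.1 (hu.1 1 (by simp)).hasDerivWithinAt
  have h2 := hasDerivWithinAt_iff_tendsto_slope.1 (hv.1 1 (by simp)).hasDerivWithinAt
  refine (h1.div h2 hv').congr' ?_
  filter_upwards [self_mem_nhdsWithin] with r hr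
  have hr1 : r - 1 ≠ 0 := sub_ne_zero.2 hr.2
  simp only [Pi.div_apply, slope_def_field, hu1, hv1, sub_zero]
  rw [div_div_div_cancel_right₀ hr1]

/-- Picone's identity in differential form: a function vanishing at both ends whose derivative
dominates `r ^ (N - 1) (μ b - λ a) u ^ p`. -/
lemma exists_picone (hp : 2 < p) (hu : IsPrincipalEigenpair p N a lam u)
    (hv : IsPrincipalEigenpair p N b mu v) (hb : ∀ r ∈ Ioo (0:ℝ) 1, 0 < b r) :
    ∃ W W' : ℝ → ℝ, ContinuousOn W (Icc 0 1) ∧ W 0 = 0 ∧ W 1 = 0 ∧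
      (∀ r ∈ Ioo (0:ℝ) 1, HasDerivAt W (W' r) r) ∧
      ∀ r ∈ Ioo (0:ℝ) 1, (mu * b r - lam * a r) * u r ^ p * r ^ (N - 1) ≤ W' r := by
  have hv' := (hv.deriv01_one_neg hp hb).ne
  have hfu := hu.hasDerivAt_flux
  have hfv := hv.hasDerivAt_flux
  obtain ⟨-, huC, -, hupos, -, hu0, hu1⟩ := hu
  obtain ⟨-, hvC, -, hvpos, -, hv0, hv1⟩ := hv
  have hq : ContinuousOn (fun r => u r * (u r / v r) ^ (p - 1)) (Icc 0 1) := by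
    intro r hr
    rcases hr.2.eq_or_lt with rfl | hr1
    · have h1 : Tendsto (fun r => u r * (u r / v r) ^ (p - 1)) (𝓝[Icc 0 1 \ {1}] 1)
          (𝓝 (u 1 * (deriv01 u 1 / deriv01 v 1) ^ (p - 1))) :=
        (((huC.continuousOn 1 hr).mono sdiff_subset).tendsto).mul
          ((tendsto_div_at_one huC hvC hu1 hv1 hv').rpow_const (Or.inr (by linarith)))
      rw [← continuousWithinAt_sdiff_self]
      simpa [ContinuousWithinAt, hu1] using h1
    · have hvr : v r ≠ 0 := (hvpos r ⟨hr.1, hr1⟩).ne'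
      exact (huC.continuousOn r hr).mul
        (((huC.continuousOn r hr).div (hvC.continuousOn r hr) hvr).rpow_const
          (Or.inr (by linarith)))
  refine ⟨fun s => s ^ (N - 1) * phi p (deriv01 u s) * u s
      - s ^ (N - 1) * phi p (deriv01 v s) * (u s * (u s / v s) ^ (p - 1)),
    fun r => -(r ^ (N - 1) * (lam * a r * u r ^ (p - 1))) * u r
        + r ^ (N - 1) * phi p (deriv01 u r) * deriv01 u r
      - (-(r ^ (N - 1) * (mu * b r * v r ^ (p - 1))) * (u r * (u r / v r) ^ (p - 1))
        + r ^ (N - 1) * phi p (deriv01 v r) * (deriv01 u r * (u r / v r) ^ (p - 1)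
          + u r * ((deriv01 u r * v r - u r * deriv01 v r) / v r ^ 2 * (p - 1)
            * (u r / v r) ^ (p - 1 - 1)))),
    ((continuousOn_flux_s11 hp huC).mul huC.continuousOn).sub ((continuousOn_flux_s11 hp hvC).mul hq),
    by simp only [flux_zero_s11 hu0, flux_zero_s11 hv0]; ring, by simp [hu1], ?_, ?_⟩
  · intro r hr
    have hur := hupos r ⟨hr.1.le, hr.2⟩
    have hvr := hvpos r ⟨hr.1.le, hr.2⟩
    exact ((hfu r hr).mul (huC.hasDerivAt hr)).sub ((hfv r hr).mul ((huC.hasDerivAt hr).mul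
      (((huC.hasDerivAt hr).div (hvC.hasDerivAt hr) hvr.ne').rpow_const
        (p := p - 1) (Or.inl (div_pos hur hvr).ne'))))
  · intro r hr
    have hur := hupos r ⟨hr.1.le, hr.2⟩
    have hvr := hvpos r ⟨hr.1.le, hr.2⟩
    have hR : 0 < u r / v r := div_pos hur hvr
    have hpic := mul_nonneg (pow_nonneg hr.1.le (N - 1))
      (picone_nonneg hp (deriv01 u r) (deriv01 v r) hR)
    have e1 : u r ^ (p - 1) * u r = u r ^ p := by
      rw [← Real.rpow_add_one hur.ne']; ring_nf
    have e2 : v r ^ (p - 1) * (u r / v r) ^ (p - 1) = u r ^ (p - 1) := by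
      rw [← Real.mul_rpow hvr.le hR.le, mul_div_cancel₀ _ hvr.ne']
    have e3 : (u r / v r) ^ (p - 1) = (u r / v r) ^ (p - 1 - 1) * (u r / v r) := by
      rw [← Real.rpow_add_one hR.ne']; ring_nf
    have e4 : (u r / v r) ^ p = (u r / v r) ^ (p - 1) * (u r / v r) := by
      rw [← Real.rpow_add_one hR.ne']; ring_nf
    have e5 : u r * ((deriv01 u r * v r - u r * deriv01 v r) / v r ^ 2 * (p - 1)
          * (u r / v r) ^ (p - 1 - 1))
        = (p - 1) * ((u r / v r) ^ (p - 1) * deriv01 u r - (u r / v r) ^ p * deriv01 v r) := by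
      rw [e4, e3]; field_simp
    beta_reduce
    rw [e5]
    refine le_of_sub_nonneg (hpic.trans_eq ?_)
    rw [← e1]
    linear_combination (-(r ^ (N - 1) * mu * b r * u r)) * e2

lemma not_forall_weight_lt (hp : 2 < p) (hu : IsPrincipalEigenpair p N a lam u)
    (hv : IsPrincipalEigenpair p N b mu v) (hb : ∀ r ∈ Ioo (0:ℝ) 1, 0 < b r) :
    ¬ ∀ r ∈ Ioo (0:ℝ) 1, lam * a r < mu * b r := by
  intro hlt
  obtain ⟨W, W', hc, hW0, hW1, hd, hge⟩ := exists_picone hp hu hv hb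
  have := lt_of_hasDerivAt_pos zero_lt_one hc hd fun r hr =>
    lt_of_lt_of_le (mul_pos (mul_pos (sub_pos.2 (hlt r hr))
      (Real.rpow_pos_of_pos (hu.2.2.2.1 r ⟨hr.1.le, hr.2⟩) _)) (pow_pos hr.1 _)) (hge r hr)
  rw [hW0, hW1] at this
  exact lt_irrefl _ this

lemma sub_le_eigenfunction (hp : 2 < p) (hN : 1 ≤ N) (hu : IsPrincipalEigenpair p N a lam u)
    (ha : ∀ r ∈ Ioo (0:ℝ) 1, 0 < a r) {C : ℝ} (hC : 0 ≤ C)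
    (haC : ∀ r ∈ Ioo (0:ℝ) 1, lam * a r ≤ C) {r : ℝ} (hr : r ∈ Icc (0:ℝ) 1) :
    u 0 - C ^ (1 / (p - 1)) * u 0 * r ≤ u r := by
  have hanti := hu.antitoneOn hp ha
  have hfu := hu.hasDerivAt_flux
  obtain ⟨hlam, huC, -, hupos, -, hu0, hu1⟩ := hu
  have h00 : 0 < u 0 := hupos 0 (by simp)
  have hN1 : (1:ℝ) ≤ N := by exact_mod_cast hN
  have hder : ∀ s ∈ Ioo (0:ℝ) 1, -(C ^ (1 / (p - 1)) * u 0) ≤ deriv01 u s := by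
    intro s hs
    have h1 := add_le_of_hasDerivAt_ge (κ := -(C * u 0 ^ (p - 1))) hN hs.1.le
      ((continuousOn_flux_s11 (N := N) hp huC).mono (Icc_subset_Icc le_rfl hs.2.le))
      (fun t ht => hfu t ⟨ht.1, ht.2.trans hs.2⟩)
      (fun t ht => by
        have ht1 : t ∈ Ioo (0:ℝ) 1 := ⟨ht.1, ht.2.trans hs.2⟩
        have hut := hupos t ⟨ht.1.le, ht1.2⟩
        have h2 : u t ^ (p - 1) ≤ u 0 ^ (p - 1) :=
          Real.rpow_le_rpow hut.le (hanti (by simp) (Ioo_subset_Icc_self ht1) ht.1.le)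
            (by linarith)
        have h3 : lam * a t * u t ^ (p - 1) ≤ C * u 0 ^ (p - 1) :=
          mul_le_mul (haC t ht1) h2 (by positivity) hC
        have := mul_le_mul_of_nonneg_right h3 (pow_nonneg ht.1.le (N - 1))
        linarith)
    rw [flux_zero_s11 hu0, zero_pow (by omega), sub_zero, zero_add] at h1
    have hsN : s ^ N = s ^ (N - 1) * s := by rw [← pow_succ]; congr 1; omega
    have hpw : 0 < s ^ (N - 1) := pow_pos hs.1 _
    have h4 : -(C * u 0 ^ (p - 1)) / N * s ≤ phi p (deriv01 u s) := by
      refine le_of_mul_le_mul_left ?_ hpw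
      rw [hsN] at h1
      linarith
    have h5 : C * u 0 ^ (p - 1) / N * s ≤ C * u 0 ^ (p - 1) := by
      have hX : 0 ≤ C * u 0 ^ (p - 1) := by positivity
      calc C * u 0 ^ (p - 1) / N * s ≤ C * u 0 ^ (p - 1) / N * 1 := by
            gcongr; exact hs.2.le
        _ ≤ C * u 0 ^ (p - 1) := by rw [mul_one]; exact div_le_self hX hN1
    have h6 : -(C * u 0 ^ (p - 1)) ≤ phi p (deriv01 u s) := by
      rw [neg_div, neg_mul] at h4
      linarith
    by_contra! hlt
    set K := C ^ (1 / (p - 1)) * u 0 with hK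
    have hK0 : 0 ≤ K := by positivity
    have hKp : K ^ (p - 1) = C * u 0 ^ (p - 1) := by
      rw [hK, Real.mul_rpow (by positivity) h00.le, ← Real.rpow_mul hC,
        one_div_mul_cancel (by linarith), Real.rpow_one]
    have h7 : K < -deriv01 u s := by linarith
    have h8 := Real.rpow_lt_rpow hK0 h7 (by linarith : 0 < p - 1)
    rw [hKp, ← phi_of_pos (hK0.trans_lt h7), phi_neg] at h8
    linarith
  have := le_of_hasDerivAt_nonneg (F := fun s => u s + C ^ (1 / (p - 1)) * u 0 * s)
    (F' := fun s => deriv01 u s + C ^ (1 / (p - 1)) * u 0 * 1) hr.1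
    ((huC.continuousOn.mono (Icc_subset_Icc le_rfl hr.2)).add (by fun_prop))
    (fun s hs => (huC.hasDerivAt ⟨hs.1, hs.2.trans_le hr.2⟩).add
      ((hasDerivAt_id s).const_mul _))
    (fun s hs => by
      have := hder s ⟨hs.1, hs.2.trans_le hr.2⟩
      linarith)
  simp only [mul_zero, add_zero] at this
  linarith

/-- A positive solution whose weight is smaller than the weight of an eigenfunction wherever the
solution is large is bounded a priori. -/
lemma exists_bound (hp : 2 < p) (hN : 1 ≤ N) (hv : IsPrincipalEigenpair p N b mu v)
    (hb : ∀ r ∈ Ioo (0:ℝ) 1, 0 < b r) {c : ℝ} (hc : 0 < c) {C : ℝ} (hC : 0 ≤ C) (M : ℝ) :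
    ∃ B : ℝ, ∀ (lam : ℝ) (a u : ℝ → ℝ), IsPrincipalEigenpair p N a lam u →
      (∀ r ∈ Ioo (0:ℝ) 1, 0 < a r) → (∀ r ∈ Ioo (0:ℝ) 1, lam * a r ≤ C) →
      (∀ r ∈ Ioo (0:ℝ) 1, M ≤ u r → lam * a r + c ≤ mu * b r) → u 0 ≤ B := by
  set M' := max M 1
  set K := C ^ (1 / (p - 1)) with hK
  have hK0 : 0 ≤ K := by positivity
  have hM1 : 1 ≤ M' := le_max_right _ _
  set r0 := 1 / (2 * (K + 1)) with hr0
  have hr0pos : 0 < r0 := by positivity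
  have hr01 : r0 < 1 := by
    rw [hr0, div_lt_one (by positivity)]
    linarith
  have hKr : K * r0 ≤ 1 / 2 := by
    rw [hr0, mul_one_div, div_le_div_iff₀ (by positivity) (by positivity)]
    linarith
  refine ⟨max (2 * M') (2 * (C * M' ^ p / (c * r0 ^ N))), ?_⟩
  intro lam a u hu ha haC hac
  by_contra! hlt
  obtain ⟨hl1, hl2⟩ := max_lt_iff.1 hlt
  obtain ⟨W, W', hWc, hW0, hW1, hd, hge⟩ := exists_picone hp hu hv hb
  have hupos := hu.2.2.2.1
  have hlow : ∀ r ∈ Ioo 0 r0, u 0 / 2 ≤ u r := by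
    intro r hr
    have h1 := sub_le_eigenfunction hp hN hu ha hC haC (r := r)
      ⟨hr.1.le, (hr.2.trans hr01).le⟩
    have h2 : K * r ≤ 1 / 2 := (mul_le_mul_of_nonneg_left hr.2.le hK0).trans hKr
    have h3 : 0 < u 0 := hupos 0 (by simp)
    rw [← hK] at h1
    nlinarith
  have hhalf : M' < u 0 / 2 := by linarith
  have s1 := add_le_of_hasDerivAt_ge (κ := c * (u 0 / 2) ^ p) hN hr0pos.le
    (hWc.mono (Icc_subset_Icc le_rfl hr01.le)) (fun r hr => hd r ⟨hr.1, hr.2.trans hr01⟩)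
    (fun r hr => by
      have hr1 : r ∈ Ioo (0:ℝ) 1 := ⟨hr.1, hr.2.trans hr01⟩
      refine le_trans ?_ (hge r hr1)
      have h1 := hlow r hr
      have h2 := hac r hr1 ((le_max_left M 1).trans (hhalf.le.trans h1))
      have h3 : (u 0 / 2) ^ p ≤ u r ^ p := Real.rpow_le_rpow (by linarith) h1 (by linarith)
      have h4 : 0 ≤ (u 0 / 2) ^ p := Real.rpow_nonneg (by linarith) _
      have h5 : c ≤ mu * b r - lam * a r := by linarith
      exact mul_le_mul_of_nonneg_right (mul_le_mul h5 h3 h4 (by linarith))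
        (pow_nonneg hr.1.le _))
  have s2 := add_le_of_hasDerivAt_ge (κ := -(C * M' ^ p)) hN hr01.le
    (hWc.mono (Icc_subset_Icc hr0pos.le le_rfl)) (fun r hr => hd r ⟨hr0pos.trans hr.1, hr.2⟩)
    (fun r hr => by
      have hr1 : r ∈ Ioo (0:ℝ) 1 := ⟨hr0pos.trans hr.1, hr.2⟩
      refine le_trans ?_ (hge r hr1)
      refine mul_le_mul_of_nonneg_right ?_ (pow_nonneg hr1.1.le _)
      have hur := hupos r ⟨hr1.1.le, hr1.2⟩
      have hup : 0 ≤ u r ^ p := Real.rpow_nonneg hur.le _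
      have hMp : 0 ≤ C * M' ^ p := mul_nonneg hC (Real.rpow_nonneg (by linarith) _)
      rcases le_or_gt M (u r) with h | h
      · have h2 := hac r hr1 h
        have : 0 ≤ (mu * b r - lam * a r) * u r ^ p := mul_nonneg (by linarith) hup
        linarith
      · have h3 : u r ^ p ≤ M' ^ p :=
          Real.rpow_le_rpow hur.le (h.le.trans (le_max_left _ _)) (by linarith)
        have h4 : C * u r ^ p ≤ C * M' ^ p := mul_le_mul_of_nonneg_left h3 hC
        have h5 : -C ≤ mu * b r - lam * a r := by
          linarith [haC r hr1, mul_pos hv.1 (hb r hr1)]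
        have := mul_le_mul_of_nonneg_right h5 hup
        linarith)
  rw [hW0, zero_pow (by omega)] at s1
  rw [hW1, one_pow] at s2
  have hNpos : (0:ℝ) < N := by exact_mod_cast hN
  have hMp : 0 ≤ C * M' ^ p := mul_nonneg hC (Real.rpow_nonneg (by linarith) _)
  have hrN : 0 < r0 ^ N := pow_pos hr0pos _
  have h1 : c * (u 0 / 2) ^ p * r0 ^ N ≤ C * M' ^ p := by
    have h2 : c * (u 0 / 2) ^ p / N * r0 ^ N - C * M' ^ p / N * (1 - r0 ^ N) ≤ 0 := by
      rw [neg_div, neg_mul] at s2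
      linarith
    have h3 : (c * (u 0 / 2) ^ p * r0 ^ N - C * M' ^ p * (1 - r0 ^ N)) / N ≤ 0 := by
      convert h2 using 1
      ring
    have h4 : c * (u 0 / 2) ^ p * r0 ^ N - C * M' ^ p * (1 - r0 ^ N) ≤ 0 := by
      by_contra! hpos
      exact absurd h3 (div_pos hpos hNpos).not_ge
    nlinarith [mul_nonneg hMp hrN.le]
  have h5 : u 0 / 2 ≤ (u 0 / 2) ^ p := by
    have := Real.rpow_le_rpow_of_exponent_le (x := u 0 / 2) (by linarith)
      (by linarith : (1:ℝ) ≤ p)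
    rwa [Real.rpow_one] at this
  have h6 : C * M' ^ p / (c * r0 ^ N) < u 0 / 2 := by linarith
  rw [div_lt_iff₀ (by positivity)] at h6
  have h7 : u 0 / 2 * (c * r0 ^ N) ≤ (u 0 / 2) ^ p * (c * r0 ^ N) :=
    mul_le_mul_of_nonneg_right h5 (by positivity)
  linarith

end Eigenpairs

section Nonlinearity

variable {p : ℝ} {N : ℕ} {f f₂ : ℝ → ℝ → ℝ} {f0 finf : ℝ → ℝ}

lemma HypH'.ratio_pos (H : HypH' p N f f₂ f0 finf) {r ξ : ℝ} (hr : r ∈ Icc (0:ℝ) 1)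
    (hξ : ξ ≠ 0) : 0 < f r ξ / phi p ξ := by
  have h1 := H.hH2 r hr ξ hξ
  have h2 : 0 < phi p ξ * ξ := by
    rw [phi_mul_self H.hp]
    exact Real.rpow_pos_of_pos (abs_pos.2 hξ) _
  have := div_pos h1 h2
  rwa [mul_div_mul_right _ _ hξ] at this

/-- The quotient `f r ξ / φ_p ξ` is nonincreasing along each half-line. -/
lemma HypH'.ratio_antitoneOn (H : HypH' p N f f₂ f0 finf) {r σ : ℝ} (hr : r ∈ Icc (0:ℝ) 1)
    (hσ : σ = 1 ∨ σ = -1) :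
    AntitoneOn (fun t => f r (σ * t) / phi p (σ * t)) (Ioi 0) := by
  have hσ2 : σ * σ = 1 := by rcases hσ with rfl | rfl <;> norm_num
  have hphi : ∀ t ∈ Ioi (0:ℝ), f r (σ * t) / phi p (σ * t) = σ * f r (σ * t) / t ^ (p - 1) := by
    intro t ht
    rw [← phi_of_pos ht]
    rcases hσ with rfl | rfl
    · simp
    · rw [neg_one_mul, phi_neg, div_neg, neg_one_mul, neg_div]
  have hd : ∀ t ∈ Ioi (0:ℝ), HasDerivAt (fun t => σ * f r (σ * t) / t ^ (p - 1))
      ((σ * (f₂ r (σ * t) * σ) * t ^ (p - 1) - σ * f r (σ * t) * ((p - 1) * t ^ (p - 1 - 1)))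
        / (t ^ (p - 1)) ^ 2) t := by
    intro t ht
    have h1 : HasDerivAt (fun t : ℝ => σ * t) σ t := by
      simpa using (hasDerivAt_id t).const_mul σ
    exact (((H.hf_deriv r hr (σ * t)).comp t h1).const_mul σ).div
      (Real.hasDerivAt_rpow_const (Or.inl (ne_of_gt ht))) (Real.rpow_pos_of_pos ht _).ne'
  refine AntitoneOn.congr (f₁ := fun t => σ * f r (σ * t) / t ^ (p - 1)) ?_
    fun t ht => (hphi t ht).symm
  refine antitoneOn_of_deriv_nonpos (convex_Ioi 0)
    (fun t ht => (hd t ht).continuousAt.continuousWithinAt) ?_ ?_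
  · rw [interior_Ioi]
    exact fun t ht => (hd t ht).differentiableAt.differentiableWithinAt
  · rw [interior_Ioi]
    intro t ht
    have ht0 : 0 < t := ht
    rw [(hd t ht).deriv]
    refine div_nonpos_of_nonpos_of_nonneg ?_ (by positivity)
    have e : t ^ (p - 1) = t ^ (p - 1 - 1) * t := by
      rw [← Real.rpow_add_one ht0.ne']; ring_nf
    have hkey : f₂ r (σ * t) * t ≤ (p - 1) * (σ * f r (σ * t)) := by
      rcases hσ with rfl | rfl
      · simpa using H.hH3p r hr t ht0.le
      · have := H.hH3m r hr (-t) (by linarith)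
        simp only [neg_one_mul]
        linarith
    have hpw : 0 ≤ t ^ (p - 1 - 1) := by positivity
    have e2 : σ * (f₂ r (σ * t) * σ) * t ^ (p - 1)
          - σ * f r (σ * t) * ((p - 1) * t ^ (p - 1 - 1))
        = t ^ (p - 1 - 1) * (f₂ r (σ * t) * t - (p - 1) * (σ * f r (σ * t))) := by
      rw [e]
      linear_combination (f₂ r (σ * t) * t * t ^ (p - 1 - 1)) * hσ2
    rw [e2]
    exact mul_nonpos_of_nonneg_of_nonpos hpw (by linarith)

lemma exists_sign_mul_abs {ξ : ℝ} : ∃ σ : ℝ, (σ = 1 ∨ σ = -1) ∧ ξ = σ * |ξ| := by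
  rcases abs_choice ξ with h | h
  · exact ⟨1, Or.inl rfl, by rw [h, one_mul]⟩
  · exact ⟨-1, Or.inr rfl, by rw [h]; ring⟩

lemma abs_sign_mul {σ t : ℝ} (hσ : σ = 1 ∨ σ = -1) (ht : 0 ≤ t) : |σ * t| = t := by
  rcases hσ with rfl | rfl <;> simp [abs_of_nonneg ht]

lemma HypH'.ratio_le (H : HypH' p N f f₂ f0 finf) {r ξ : ℝ} (hr : r ∈ Icc (0:ℝ) 1)
    (hξ : ξ ≠ 0) : f r ξ / phi p ξ ≤ f0 r := by
  refine le_of_forall_pos_le_add fun e he => ?_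
  obtain ⟨d, hd, hlt⟩ := H.hH4a e he
  obtain ⟨σ, hσ, hξσ⟩ := exists_sign_mul_abs (ξ := ξ)
  have hx : 0 < |ξ| := abs_pos.2 hξ
  have ht : 0 < min (d / 2) |ξ| := lt_min (by linarith) hx
  have h1 := H.ratio_antitoneOn hr hσ ht hx (min_le_right _ _)
  have habs := abs_sign_mul hσ ht.le
  have h2 := hlt (σ * min (d / 2) |ξ|) (abs_pos.1 (by rwa [habs]))
    (by rw [habs]; exact (min_le_left _ _).trans_lt (by linarith)) r hr
  simp only [← hξσ] at h1
  linarith [(abs_lt.1 h2).2]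

lemma HypH'.le_ratio (H : HypH' p N f f₂ f0 finf) {r ξ : ℝ} (hr : r ∈ Icc (0:ℝ) 1)
    (hξ : ξ ≠ 0) : finf r ≤ f r ξ / phi p ξ := by
  refine le_of_forall_pos_le_add fun e he => ?_
  obtain ⟨M, hM⟩ := H.hH5 e he
  obtain ⟨σ, hσ, hξσ⟩ := exists_sign_mul_abs (ξ := ξ)
  have hx : 0 < |ξ| := abs_pos.2 hξ
  have ht : 0 < max M |ξ| := hx.trans_le (le_max_right _ _)
  have h1 := H.ratio_antitoneOn hr hσ hx ht (le_max_right _ _)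
  have h2 := hM (σ * max M |ξ|) (by rw [abs_sign_mul hσ ht.le]; exact le_max_left _ _) r hr
  simp only [← hξσ] at h1
  linarith [(abs_lt.1 h2).1]

lemma HypH'.f0_pos (H : HypH' p N f f₂ f0 finf) {r : ℝ} (hr : r ∈ Icc (0:ℝ) 1) : 0 < f0 r :=
  (H.ratio_pos hr one_ne_zero).trans_le (H.ratio_le hr one_ne_zero)

lemma IsSolutionP.exists_sign {lam : ℝ} {u : ℝ → ℝ} (hu : IsSolutionP p N f lam u)
    (hsd : SignDef u) :
    ∃ σ : ℝ, (σ = 1 ∨ σ = -1) ∧ (∀ r ∈ Icc (0:ℝ) 1, 0 ≤ σ * u r) ∧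
      C1on01 (fun r => σ * u r) ∧ C1on01 (fun r => phi p (deriv01 (fun r => σ * u r) r)) ∧
      (∀ r, phi p (deriv01 (fun r => σ * u r) r) = σ * phi p (deriv01 u r)) ∧
      deriv01 (fun r => σ * u r) 0 = 0 := by
  rcases hsd with h | h
  · refine ⟨1, Or.inl rfl, ?_⟩
    simp only [one_mul]
    exact ⟨h, hu.1, hu.2.1, fun _ => trivial, hu.2.2.2.1⟩
  · have hder : deriv01 (fun r => -u r) = fun r => -deriv01 u r := by
      funext r
      exact derivWithin.fun_neg
    refine ⟨-1, Or.inr rfl, ?_⟩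
    simp only [neg_one_mul, hder, phi_neg]
    exact ⟨fun r hr => neg_nonneg.2 (h r hr), hu.1.neg, hu.2.1.neg, fun _ => trivial,
      by rw [hu.2.2.2.1, neg_zero]⟩

lemma norm0_eq_of_antitoneOn {u w : ℝ → ℝ} (hw : AntitoneOn w (Icc 0 1))
    (h : ∀ r ∈ Icc (0:ℝ) 1, |u r| = w r) : norm0 u = w 0 := by
  have h0 : (0:ℝ) ∈ Icc (0:ℝ) 1 := by simp
  refine IsGreatest.csSup_eq ⟨⟨0, h0, h 0 h0⟩, ?_⟩
  rintro _ ⟨r, hr, rfl⟩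
  exact (h r hr).trans_le (hw h0 hr hr.1)

/-- The absolute value of a nontrivial sign-definite solution is a principal eigenfunction for the
weight `f(r, u(r)) / φ_p(u(r))`. -/
lemma HypH'.exists_eigenpair (H : HypH' p N f f₂ f0 finf) {lam : ℝ} (hlam : 0 < lam)
    {u : ℝ → ℝ} (hu : IsSolutionP p N f lam u) (hnt : Nontriv01 u) (hsd : SignDef u) :
    ∃ w : ℝ → ℝ, IsPrincipalEigenpair p N (fun r => f r (u r) / phi p (u r)) lam w ∧
      AntitoneOn w (Icc 0 1) ∧ norm0 u = w 0 ∧ ∀ r ∈ Ioo (0:ℝ) 1, u r ≠ 0 ∧ |u r| = w r := by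
  obtain ⟨σ, hσ, hnn, hC, hC', hphi, h0⟩ := hu.exists_sign hsd
  obtain ⟨-, -, hd, -, hu1⟩ := hu
  have hσ2 : σ * σ = 1 := by rcases hσ with rfl | rfl <;> norm_num
  have hσ0 : σ ≠ 0 := by rintro rfl; norm_num at hσ2
  have habs : ∀ r ∈ Icc (0:ℝ) 1, |u r| = σ * u r := by
    intro r hr
    rw [← abs_of_nonneg (hnn r hr), abs_mul]
    rcases hσ with rfl | rfl <;> simp
  have hd' : ∀ r ∈ Ioo (0:ℝ) 1,
      HasDerivAt (fun s => s ^ (N - 1) * phi p (deriv01 (fun r => σ * u r) s))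
        (-(r ^ (N - 1) * (lam * (σ * f r (u r))))) r := by
    intro r hr
    simp only [hphi]
    refine (((hd r hr).const_mul σ).congr_deriv (by ring)).congr_of_eventuallyEq
      (Eventually.of_forall fun s => by ring)
  have hpos' : ∀ r ∈ Icc (0:ℝ) 1, u r ≠ 0 → 0 < σ * f r (u r) := by
    intro r hr hne
    have h1 := H.hH2 r hr _ hne
    have h2 : 0 < σ * u r := (hnn r hr).lt_of_ne' (mul_ne_zero hσ0 hne)
    refine pos_of_mul_pos_left (b := σ * u r) ?_ h2.le
    have : σ * f r (u r) * (σ * u r) = σ * σ * (f r (u r) * u r) := by ring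
    rwa [this, hσ2, one_mul]
  have hh : ∀ r ∈ Ioo (0:ℝ) 1, 0 ≤ lam * (σ * f r (u r)) := by
    intro r hr
    rcases eq_or_ne (u r) 0 with he | hne
    · rw [he, H.hf_zero r (Ioo_subset_Icc_self hr), mul_zero, mul_zero]
    · exact (mul_pos hlam (hpos' r (Ioo_subset_Icc_self hr) hne)).le
  have hpos := radial_pos H.hp hC hd' hh
    (fun r hr h => mul_pos hlam (hpos' r (Ioo_subset_Icc_self hr) (right_ne_zero_of_mul h.ne')))
    h0 hnn (by
      obtain ⟨r, hr, hne⟩ := hnt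
      exact ⟨r, hr, mul_ne_zero hσ0 hne⟩)
  have hanti := radial_antitone H.hp hC hd' hh h0
  refine ⟨fun r => σ * u r, ⟨hlam, hC, hC', hpos, fun r hr => ?_, h0, by simp [hu1]⟩, hanti,
    norm0_eq_of_antitoneOn hanti habs, fun r hr =>
      ⟨right_ne_zero_of_mul (hpos r ⟨hr.1.le, hr.2⟩).ne', habs r (Ioo_subset_Icc_self hr)⟩⟩
  have hne : u r ≠ 0 := right_ne_zero_of_mul (hpos r ⟨hr.1.le, hr.2⟩).ne'
  have hs : phi p (σ * u r) = σ * phi p (u r) := by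
    rcases hσ with rfl | rfl
    · simp
    · simp [phi_neg]
  convert hd' r hr using 1
  rw [hs]
  have := phi_ne_zero (p := p) hne
  field_simp

lemma exists_pos_le_of_continuousOn {w : ℝ → ℝ} (hw : ContinuousOn w (Icc 0 1))
    (hpos : ∀ r ∈ Icc (0:ℝ) 1, 0 < w r) : ∃ m > 0, ∀ r ∈ Icc (0:ℝ) 1, m ≤ w r := by
  obtain ⟨x, hx, hmin⟩ := isCompact_Icc.exists_isMinOn (nonempty_Icc.2 zero_le_one) hw
  exact ⟨w x, hpos x hx, fun r hr => hmin hr⟩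

lemma HypH'.lam0_le (H : HypH' p N f f₂ f0 finf) {lam0 : ℝ} {v0 : ℝ → ℝ}
    (hv0 : IsPrincipalEigenpair p N f0 lam0 v0) {lam : ℝ} (hlam : 0 < lam) {u : ℝ → ℝ}
    (hu : IsSolutionP p N f lam u) (hnt : Nontriv01 u) (hsd : SignDef u) : lam0 ≤ lam := by
  obtain ⟨w, hw, -, -, hne⟩ := H.exists_eigenpair hlam hu hnt hsd
  by_contra! hlt
  refine not_forall_weight_lt H.hp hw hv0 (fun r hr => H.f0_pos (Ioo_subset_Icc_self hr)) ?_
  intro r hr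
  have hr' := Ioo_subset_Icc_self hr
  exact (mul_le_mul_of_nonneg_left (H.ratio_le hr' (hne r hr).1) hlam.le).trans_lt
    (mul_lt_mul_of_pos_right hlt (H.f0_pos hr'))

lemma HypH'.le_lamInf (H : HypH' p N f f₂ f0 finf) {lamInf : ℝ} {v : ℝ → ℝ}
    (hv : IsPrincipalEigenpair p N finf lamInf v) {lam : ℝ} (hlam : 0 < lam) {u : ℝ → ℝ}
    (hu : IsSolutionP p N f lam u) (hnt : Nontriv01 u) (hsd : SignDef u) : lam ≤ lamInf := by
  obtain ⟨w, hw, -, -, hne⟩ := H.exists_eigenpair hlam hu hnt hsd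
  by_contra! hlt
  refine not_forall_weight_lt H.hp hv hw
    (fun r hr => H.ratio_pos (Ioo_subset_Icc_self hr) (hne r hr).1) ?_
  intro r hr
  have hr' := Ioo_subset_Icc_self hr
  exact (mul_le_mul_of_nonneg_left (H.le_ratio hr' (hne r hr).1) hv.1.le).trans_lt
    (mul_lt_mul_of_pos_right hlt (H.ratio_pos hr' (hne r hr).1))

/-- Solutions of small norm have parameter close to `λ₀`. -/
lemma HypH'.exists_norm0_lt_imp (H : HypH' p N f f₂ f0 finf) {lam0 : ℝ} {v0 : ℝ → ℝ}
    (hv0 : IsPrincipalEigenpair p N f0 lam0 v0) {ε : ℝ} (hε : 0 < ε) :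
    ∃ d > 0, ∀ (lam : ℝ) (u : ℝ → ℝ), 0 < lam → IsSolutionP p N f lam u → Nontriv01 u →
      SignDef u → norm0 u < d → lam < lam0 + ε := by
  obtain ⟨m, hm, hmle⟩ := exists_pos_le_of_continuousOn H.hf0_cont fun r hr => H.f0_pos hr
  have hL : 0 < lam0 + ε := add_pos hv0.1 hε
  obtain ⟨d, hd, hdlt⟩ := H.hH4a (ε * m / (lam0 + ε)) (by positivity)
  refine ⟨d, hd, fun lam u hlam hu hnt hsd hnorm => ?_⟩
  obtain ⟨w, hw, hanti, hw0, hne⟩ := H.exists_eigenpair hlam hu hnt hsd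
  by_contra! hge
  refine not_forall_weight_lt H.hp hv0 hw
    (fun r hr => H.ratio_pos (Ioo_subset_Icc_self hr) (hne r hr).1) ?_
  intro r hr
  have hr' := Ioo_subset_Icc_self hr
  have h1 : |u r| < d := by
    rw [(hne r hr).2]
    exact (hanti (by simp) hr' hr'.1).trans_lt (hw0 ▸ hnorm)
  have h2 := (abs_lt.1 (hdlt (u r) (hne r hr).1 h1 r hr')).1
  have h3 : f0 r - ε * m / (lam0 + ε) < f r (u r) / phi p (u r) := by linarith
  have h4 := mul_lt_mul_of_pos_left h3 hL
  have h5 := mul_le_mul_of_nonneg_right hge (H.ratio_pos hr' (hne r hr).1).le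
  have h6 : (lam0 + ε) * (f0 r - ε * m / (lam0 + ε)) = lam0 * f0 r + ε * (f0 r - m) := by
    field_simp
    ring
  have h7 : 0 ≤ ε * (f0 r - m) := mul_nonneg hε.le (sub_nonneg.2 (hmle r hr'))
  linarith

/-- Solutions with parameter at most `L` are bounded a priori as soon as `L f_∞` is uniformly
smaller than `μ b` for some principal eigenpair with weight `b`. -/
lemma HypH'.exists_norm0_bound (H : HypH' p N f f₂ f0 finf) {b v : ℝ → ℝ} {mu : ℝ}
    (hv : IsPrincipalEigenpair p N b mu v) (hb : ∀ r ∈ Ioo (0:ℝ) 1, 0 < b r) {L c : ℝ}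
    (hL : 0 < L) (hc : 0 < c) (hlt : ∀ r ∈ Ioo (0:ℝ) 1, L * finf r + c ≤ mu * b r) :
    ∃ B : ℝ, ∀ (lam : ℝ) (u : ℝ → ℝ), 0 < lam → IsSolutionP p N f lam u → Nontriv01 u →
      SignDef u → lam ≤ L → norm0 u ≤ B := by
  obtain ⟨A, hA⟩ := isCompact_Icc.bddAbove_image H.hf0_cont
  have hA' : ∀ r ∈ Icc (0:ℝ) 1, f0 r ≤ A := fun r hr => hA (mem_image_of_mem _ hr)
  have hA0 : 0 ≤ A := (H.f0_pos (r := 0) (by simp)).le.trans (hA' 0 (by simp))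
  obtain ⟨M, hM⟩ := H.hH5 (c / (2 * L)) (by positivity)
  obtain ⟨B, hB⟩ := exists_bound H.hp H.hN hv hb (half_pos hc) (mul_nonneg hL.le hA0) M
  refine ⟨B, fun lam u hlam hu hnt hsd hle => ?_⟩
  obtain ⟨w, hw, -, hw0, hne⟩ := H.exists_eigenpair hlam hu hnt hsd
  rw [hw0]
  refine hB lam _ w hw (fun r hr => H.ratio_pos (Ioo_subset_Icc_self hr) (hne r hr).1) ?_ ?_
  · intro r hr
    have hr' := Ioo_subset_Icc_self hr
    exact mul_le_mul hle ((H.ratio_le hr' (hne r hr).1).trans (hA' r hr'))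
      (H.ratio_pos hr' (hne r hr).1).le hL.le
  · intro r hr hMr
    have hr' := Ioo_subset_Icc_self hr
    have h1 := (abs_lt.1 (hM (u r) ((hne r hr).2 ▸ hMr) r hr')).2
    have h2 := mul_le_mul_of_nonneg_right hle (H.ratio_pos hr' (hne r hr).1).le
    have h3 : L * (f r (u r) / phi p (u r)) ≤ L * (finf r + c / (2 * L)) :=
      mul_le_mul_of_nonneg_left (by linarith) hL.le
    have h4 : L * (finf r + c / (2 * L)) = L * finf r + c / 2 := by
      field_simp
    linarith [hlt r hr]

end Nonlinearity

/-- under (H'), the analogue of Statement 10 for sign-definite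
nontrivial solutions. -/
theorem stmt_11 (p : ℝ) (N : ℕ) (f f₂ : ℝ → ℝ → ℝ) (f0 finf : ℝ → ℝ)
    (H : HypH' p N f f₂ f0 finf)
    (lam0 : ℝ) (hlam0 : ∃ v, IsPrincipalEigenpair p N f0 lam0 v) :
    -- (a) lower bound
    (∀ (lam : ℝ) (u : ℝ → ℝ), 0 < lam → IsSolutionP p N f lam u → Nontriv01 u →
      SignDef u → lam0 ≤ lam) ∧
    -- (a) upper bound when f∞ has a principal eigenvalue
    (∀ lamInf : ℝ, (∃ v, IsPrincipalEigenpair p N finf lamInf v) →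
      ∀ (lam : ℝ) (u : ℝ → ℝ), 0 < lam → IsSolutionP p N f lam u → Nontriv01 u →
        SignDef u → lam ≤ lamInf) ∧
    -- (b)
    (∀ (lamn : ℕ → ℝ) (un : ℕ → ℝ → ℝ),
      (∀ n, 0 < lamn n) → (∀ n, IsSolutionP p N f (lamn n) (un n)) →
      (∀ n, Nontriv01 (un n)) → (∀ n, SignDef (un n)) →
      Filter.Tendsto (fun n => norm0 (un n)) Filter.atTop (nhds 0) →
      Filter.Tendsto lamn Filter.atTop (nhds lam0)) ∧
    -- (c) case f∞ > 0
    (∀ lamInf : ℝ, (∃ v, IsPrincipalEigenpair p N finf lamInf v) →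
      ∀ (lamn : ℕ → ℝ) (un : ℕ → ℝ → ℝ),
        (∀ n, 0 < lamn n) → (∀ n, IsSolutionP p N f (lamn n) (un n)) →
        (∀ n, Nontriv01 (un n)) → (∀ n, SignDef (un n)) →
        Filter.Tendsto (fun n => norm0 (un n)) Filter.atTop Filter.atTop →
        Filter.Tendsto lamn Filter.atTop (nhds lamInf)) ∧
    -- (c) case f∞ ≡ 0, N = 1
    ((N = 1 ∧ ∀ r ∈ Set.Icc (0:ℝ) 1, finf r = 0) →
      ∀ (lamn : ℕ → ℝ) (un : ℕ → ℝ → ℝ),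
        (∀ n, 0 < lamn n) → (∀ n, IsSolutionP p N f (lamn n) (un n)) →
        (∀ n, Nontriv01 (un n)) → (∀ n, SignDef (un n)) →
        Filter.Tendsto (fun n => norm0 (un n)) Filter.atTop Filter.atTop →
        Filter.Tendsto lamn Filter.atTop Filter.atTop) := by
  obtain ⟨v0, hv0⟩ := hlam0
  have hf0 : ∀ r ∈ Ioo (0:ℝ) 1, 0 < f0 r := fun r hr => H.f0_pos (Ioo_subset_Icc_self hr)
  refine ⟨fun lam u hlam hu hnt hsd => H.lam0_le hv0 hlam hu hnt hsd,
    fun lamInf ⟨v, hv⟩ lam u hlam hu hnt hsd => H.le_lamInf hv hlam hu hnt hsd, ?_, ?_, ?_⟩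
  · intro lamn un hlam hu hnt hsd hlim
    rw [tendsto_order]
    refine ⟨fun x hx => Eventually.of_forall fun n =>
      hx.trans_le (H.lam0_le hv0 (hlam n) (hu n) (hnt n) (hsd n)), fun x hx => ?_⟩
    obtain ⟨d, hd, himp⟩ := H.exists_norm0_lt_imp hv0 (sub_pos.2 hx)
    filter_upwards [hlim.eventually_lt_const hd] with n hn
    simpa using himp _ _ (hlam n) (hu n) (hnt n) (hsd n) hn
  · rintro lamInf ⟨v, hv⟩ lamn un hlam hu hnt hsd hlim
    have hpos : ∀ r ∈ Icc (0:ℝ) 1, 0 < finf r := by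
      refine H.hH6.resolve_right fun h => not_forall_weight_lt H.hp hv hv0 hf0 fun r hr => ?_
      rw [h.2 r (Ioo_subset_Icc_self hr), mul_zero]
      exact mul_pos hv0.1 (hf0 r hr)
    obtain ⟨m, hm, hmle⟩ := exists_pos_le_of_continuousOn H.hfinf_cont hpos
    rw [tendsto_order]
    refine ⟨fun x hx => ?_, fun x hx => Eventually.of_forall fun n =>
      (H.le_lamInf hv (hlam n) (hu n) (hnt n) (hsd n)).trans_lt hx⟩
    have hx' : max x (lamInf / 2) < lamInf := max_lt hx (half_lt_self hv.1)
    obtain ⟨B, hB⟩ := H.exists_norm0_bound hv (fun r hr => hpos r (Ioo_subset_Icc_self hr))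
      (L := max x (lamInf / 2)) (c := (lamInf - max x (lamInf / 2)) * m)
      ((half_pos hv.1).trans_le (le_max_right _ _)) (mul_pos (sub_pos.2 hx') hm) (fun r hr => by
        have := mul_le_mul_of_nonneg_left (hmle r (Ioo_subset_Icc_self hr)) (sub_pos.2 hx').le
        linarith)
    filter_upwards [hlim.eventually_gt_atTop B] with n hn
    by_contra! hle
    exact (hB _ _ (hlam n) (hu n) (hnt n) (hsd n) (hle.trans (le_max_left _ _))).not_gt hn
  · rintro ⟨-, hzero⟩ lamn un hlam hu hnt hsd hlim
    obtain ⟨m, hm, hmle⟩ := exists_pos_le_of_continuousOn H.hf0_cont fun r hr => H.f0_pos hr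
    refine tendsto_atTop.2 fun x => ?_
    obtain ⟨B, hB⟩ := H.exists_norm0_bound hv0 hf0 (L := max x 1) (c := lam0 * m)
      (zero_lt_one.trans_le (le_max_right _ _)) (mul_pos hv0.1 hm) (fun r hr => by
        rw [hzero r (Ioo_subset_Icc_self hr), mul_zero, zero_add]
        exact mul_le_mul_of_nonneg_left (hmle r (Ioo_subset_Icc_self hr)) hv0.1.le)
    filter_upwards [hlim.eventually_gt_atTop B] with n hn
    by_contra! hle
    exact (hB _ _ (hlam n) (hu n) (hnt n) (hsd n) (hle.le.trans (le_max_left _ _))).not_gt hn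
end
end
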